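/- arXiv:1310.8217 — 2 statements merged into one kernel-verified Lean document; each statement's English description precedes it below -/
import Mathlib

section
/- For a bounded open set E ⊆ ℝ^d with d ≥ 3 and α ∈ (d−2, d), the unique minimizing measure μ of the Riesz energy I_α(E) has support equal to the closure of E. In particular, if v(x) := ∫ |x−y|^{−α} dμ(y) is the potential, then v is superharmonic nowhere-harmonic on the support: if there existed an open ball B_r(x) ⊆ E disjoint from supp(μ), then v would be harmonic with Δv > 0 on B_r(x), a contradiction since v ≡ I_α(E) there. -/
open MeasureTheory Metric Filter Set ENNReal

noncomputable def rieszEnergyOf {d : ℕ} (α : ℝ)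
    (μ : Measure (EuclideanSpace ℝ (Fin d))) : ℝ≥0∞ :=
  ∫⁻ x, ∫⁻ y, (edist x y) ^ (-α) ∂μ ∂μ

noncomputable def rieszEnergy {d : ℕ} (α : ℝ)
    (A : Set (EuclideanSpace ℝ (Fin d))) : ℝ≥0∞ :=
  ⨅ (μ : Measure (EuclideanSpace ℝ (Fin d))) (_ : IsProbabilityMeasure μ ∧ μ A = 1),
    rieszEnergyOf α μ

/-- The (topological) support of a measure. -/
def msupport {X : Type*} [TopologicalSpace X] [MeasurableSpace X]
    (μ : Measure X) : Set X :=
  {x | ∀ U ∈ nhds x, 0 < μ U}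

theorem two_add_le_rpow_neg_add_rpow_neg {β x : ℝ} (hβ : 0 < β) (hx0 : 0 ≤ x) (hx1 : x < 1) :
    2 + β * (β + 1) * x ^ 2 ≤ (1 + x) ^ (-β) + (1 - x) ^ (-β) := by
  have hder : ∀ p : ℝ, ∀ t ∈ Ico (0 : ℝ) 1,
      HasDerivAt (fun t : ℝ => (1 + t) ^ (-p)) (-p * (1 + t) ^ (-(p + 1))) t ∧
      HasDerivAt (fun t : ℝ => (1 - t) ^ (-p)) (p * (1 - t) ^ (-(p + 1))) t := by
    intro p t ht
    constructor
    · have := ((hasDerivAt_id t).const_add 1).rpow_const (p := -p) (Or.inl (by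
        simp only [id]; linarith [ht.1]))
      exact this.congr_deriv (by
        rw [show -p - 1 = -(p + 1) by ring]; simp only [id]; ring)
    · have := ((hasDerivAt_id t).const_sub 1).rpow_const (p := -p) (Or.inl (by
        simp only [id]; linarith [ht.2]))
      exact this.congr_deriv (by
        rw [show -p - 1 = -(p + 1) by ring]; simp only [id]; ring)
  have key : ∀ (f f' : ℝ → ℝ), (∀ t ∈ Ico (0 : ℝ) 1, HasDerivAt f (f' t) t) →
      (∀ t ∈ Ico (0 : ℝ) 1, 0 ≤ f' t) → ∀ t ∈ Ico (0 : ℝ) 1, f 0 ≤ f t := by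
    intro f f' hf hf' t ht
    have : MonotoneOn f (Ico 0 1) := by
      apply monotoneOn_of_deriv_nonneg (convex_Ico 0 1)
      · exact fun s hs => (hf s hs).continuousAt.continuousWithinAt
      · exact fun s hs => (hf s (interior_subset hs)).differentiableAt.differentiableWithinAt
      · intro s hs
        rw [(hf s (interior_subset hs)).deriv]
        exact hf' s (interior_subset hs)
    exact this (by simp) ht ht.1
  have h2 : ∀ t ∈ Ico (0 : ℝ) 1, 2 ≤ (1 + t) ^ (-(β + 2)) + (1 - t) ^ (-(β + 2)) := by
    intro t ht
    have := key (fun t => (1 + t) ^ (-(β + 2)) + (1 - t) ^ (-(β + 2)))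
      (fun t => -(β + 2) * (1 + t) ^ (-(β + 2 + 1)) + (β + 2) * (1 - t) ^ (-(β + 2 + 1)))
      (fun t ht => (hder (β + 2) t ht).1.add (hder (β + 2) t ht).2) (by
        intro t ht
        have : (1 + t) ^ (-(β + 2 + 1)) ≤ (1 - t) ^ (-(β + 2 + 1)) :=
          Real.rpow_le_rpow_of_nonpos (by linarith [ht.2]) (by linarith [ht.1]) (by linarith)
        nlinarith) t ht
    norm_num at this ⊢
    linarith
  have h1 : ∀ t ∈ Ico (0 : ℝ) 1,
      0 ≤ (1 - t) ^ (-(β + 1)) - (1 + t) ^ (-(β + 1)) - 2 * (β + 1) * t := by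
    intro t ht
    have := key (fun t => (1 - t) ^ (-(β + 1)) - (1 + t) ^ (-(β + 1)) - 2 * (β + 1) * t)
      (fun t => (β + 1) * (1 - t) ^ (-(β + 1 + 1)) - -(β + 1) * (1 + t) ^ (-(β + 1 + 1))
        - 2 * (β + 1) * 1)
      (fun t ht => ((hder (β + 1) t ht).2.sub (hder (β + 1) t ht).1).sub
        ((hasDerivAt_id t).const_mul _)) (by
        intro t ht
        have := h2 t ht
        rw [show β + 1 + 1 = β + 2 by ring]
        nlinarith) t ht
    norm_num at this ⊢
    linarith
  have := key (fun t => (1 + t) ^ (-β) + (1 - t) ^ (-β) - β * (β + 1) * t ^ 2)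
    (fun t => -β * (1 + t) ^ (-(β + 1)) + β * (1 - t) ^ (-(β + 1)) - β * (β + 1) * (2 * t))
    (fun t ht => ((hder β t ht).1.add (hder β t ht).2).sub (by
      simpa using ((hasDerivAt_pow 2 t).const_mul (β * (β + 1))))) (by
      intro t ht
      have := h1 t ht
      nlinarith) x ⟨hx0, hx1⟩
  norm_num at this ⊢
  linarith

theorem exists_lt_one_add_rpow_neg_mul {β D : ℝ} (hβ : 0 < β) (hD : D < 2 * β + 2) :
    ∃ q₀ > 0, ∀ q, 0 < q → q ≤ q₀ →
      D < (1 + q) ^ (-β) * (D + 2 * β * (β + 1) * (q / (1 + q) ^ 2)) := by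
  have hd : HasDerivAt (fun q : ℝ => (1 + q) ^ (-β) * (D + 2 * β * (β + 1) * (q / (1 + q) ^ 2)))
      (β * (2 * β + 2 - D)) 0 := by
    have h1 := ((hasDerivAt_id (0 : ℝ)).const_add 1).rpow_const (p := -β) (Or.inl (by simp))
    have h2 := (((hasDerivAt_id (0 : ℝ)).div (((hasDerivAt_id (0 : ℝ)).const_add 1).pow 2)
      (by simp)).const_mul (2 * β * (β + 1))).const_add D
    exact (h1.mul h2).congr_deriv (by simp; ring_nf)
  have hpos : 0 < β * (2 * β + 2 - D) := mul_pos hβ (by linarith)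
  have := (hasDerivAt_iff_tendsto_slope.1 hd).eventually (lt_mem_nhds hpos)
  have h3 : ∀ᶠ q in nhdsWithin (0 : ℝ) (Ioi 0),
      D < (1 + q) ^ (-β) * (D + 2 * β * (β + 1) * (q / (1 + q) ^ 2)) := by
    filter_upwards [this.filter_mono (nhdsWithin_mono 0 (fun x (hx : 0 < x) => hx.ne')),
      self_mem_nhdsWithin] with q hq hq0
    have hq0 : 0 < q := hq0
    rw [slope_def_field] at hq
    have := (div_pos_iff_of_pos_right (by simpa using hq0)).1 hq
    simp at this
    linarith
  obtain ⟨u, hu, hu'⟩ := mem_nhdsGT_iff_exists_Ioc_subset.1 h3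
  exact ⟨u, hu, fun q h0 h1 => hu' ⟨h0, h1⟩⟩

/-- The discrete Laplacian of `‖u‖ ^ (-α)` at small scales is positive, uniformly away from `0`,
when `d < α + 2`. -/
theorem exists_lt_sum_norm_rpow_neg {d : ℕ} {α ρ s : ℝ} (hα : 0 < α) (hd : (d : ℝ) < α + 2)
    (hρ : 0 < ρ) (hs : 0 < s) :
    ∃ h : ℝ, 0 < h ∧ h < s ∧ h < ρ ∧ ∀ u : EuclideanSpace ℝ (Fin d), ρ ≤ ‖u‖ →
      2 * d * ‖u‖ ^ (-α) < ∑ i : Fin d, (‖u + h • EuclideanSpace.single i (1 : ℝ)‖ ^ (-α)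
        + ‖u - h • EuclideanSpace.single i (1 : ℝ)‖ ^ (-α)) := by
  obtain ⟨β, rfl⟩ : ∃ β, α = 2 * β := ⟨α / 2, by ring⟩
  have hβ : 0 < β := by linarith
  obtain ⟨q₀, hq₀, hq⟩ := exists_lt_one_add_rpow_neg_mul hβ hd
  have hpow : ∀ v : EuclideanSpace ℝ (Fin d), ‖v‖ ^ (-(2 * β)) = (‖v‖ ^ 2) ^ (-β) := by
    intro v
    rw [← Real.rpow_natCast, ← Real.rpow_mul (norm_nonneg v)]
    congr 1; push_cast; ring
  obtain ⟨h, hh0, hh⟩ : ∃ h : ℝ, 0 < h ∧ h < min (min s ρ) (√q₀ * ρ) :=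
    exists_between (lt_min (lt_min hs hρ) (mul_pos (Real.sqrt_pos.2 hq₀) hρ))
  simp only [lt_min_iff] at hh
  obtain ⟨⟨hhs, hhρ⟩, hhq⟩ := hh
  refine ⟨h, hh0, hhs, hhρ, fun u hu => ?_⟩
  set r := ‖u‖
  have hr : 0 < r := hρ.trans_le hu
  set q := h ^ 2 / r ^ 2 with hqdef
  have hq0 : 0 < q := by positivity
  have hqq : q ≤ q₀ := by
    rw [hqdef, div_le_iff₀ (by positivity)]
    have h1 : h ^ 2 ≤ (√q₀ * ρ) ^ 2 := by gcongr
    rw [mul_pow, Real.sq_sqrt hq₀.le] at h1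
    refine h1.trans ?_
    gcongr
  have hmain := hq q hq0 hqq
  have hA : r ^ 2 + h ^ 2 = r ^ 2 * (1 + q) := by rw [hqdef]; field_simp
  set A := r ^ 2 + h ^ 2 with hAdef
  have hApos : 0 < A := by positivity
  have hterm : ∀ i : Fin d, A ^ (-β) * (2 + β * (β + 1) * (4 * h ^ 2 / A ^ 2) * u i ^ 2) ≤
      ‖u + h • EuclideanSpace.single i (1 : ℝ)‖ ^ (-(2 * β))
        + ‖u - h • EuclideanSpace.single i (1 : ℝ)‖ ^ (-(2 * β)) := by
    intro i
    have hin : inner ℝ u (h • EuclideanSpace.single i (1 : ℝ)) = h * u i := by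
      simp [inner_smul_right, EuclideanSpace.inner_single_right]
    have hn : ‖h • EuclideanSpace.single i (1 : ℝ)‖ = h := by
      simp [norm_smul, abs_of_pos hh0]
    rw [hpow, hpow, norm_add_sq_real, norm_sub_sq_real, hin, hn]
    have e1 : ‖u‖ ^ 2 + 2 * (h * u i) + h ^ 2 = A * (1 + 2 * h * u i / A) := by
      rw [mul_add, mul_div_cancel₀ _ hApos.ne']; simp only [hAdef, r]; ring
    have e2 : ‖u‖ ^ 2 - 2 * (h * u i) + h ^ 2 = A * (1 - 2 * h * u i / A) := by
      rw [mul_sub, mul_div_cancel₀ _ hApos.ne']; simp only [hAdef, r]; ring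
    have habs : |2 * h * u i / A| < 1 := by
      rw [abs_div, abs_of_pos hApos, div_lt_one hApos, abs_mul, abs_of_pos (by positivity)]
      have h1 : |u i| ≤ r := by simpa using PiLp.norm_apply_le u i
      have h2 : h < r := hhρ.trans_le hu
      nlinarith [mul_pos (sub_pos.2 h2) (sub_pos.2 h2), mul_le_mul_of_nonneg_left h1 hh0.le]
    have hlt := abs_lt.1 habs
    rw [e1, e2, Real.mul_rpow hApos.le (by linarith), Real.mul_rpow hApos.le (by linarith),
      ← mul_add]
    refine mul_le_mul_of_nonneg_left ?_ (by positivity)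
    have hkey := two_add_le_rpow_neg_add_rpow_neg hβ (abs_nonneg _) habs
    have hx : β * (β + 1) * |2 * h * u i / A| ^ 2 =
        β * (β + 1) * (4 * h ^ 2 / A ^ 2) * u i ^ 2 := by
      rw [sq_abs]; ring_nf
    rw [hx] at hkey
    rcases abs_choice (2 * h * u i / A) with h3 | h3
    · rwa [h3] at hkey
    · rw [h3] at hkey
      rw [add_comm ((1 + _) ^ (-β)), sub_eq_add_neg]
      simpa using hkey
  refine lt_of_lt_of_le ?_ (Finset.sum_le_sum fun i _ => hterm i)
  rw [← Finset.mul_sum, Finset.sum_add_distrib, ← Finset.mul_sum]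
  have hsum : ∑ i, u i ^ 2 = r ^ 2 := by
    simp only [r]; rw [EuclideanSpace.real_norm_sq_eq]
  have hfac : β * (β + 1) * (4 * h ^ 2 / A ^ 2) * r ^ 2 =
      2 * (2 * β * (β + 1) * (q / (1 + q) ^ 2)) := by
    rw [hA, hqdef]; field_simp; ring
  rw [hsum, hfac, hA, Real.mul_rpow (by positivity) (by positivity)]
  have hrp : 0 < (r ^ 2) ^ (-β) := by positivity
  have : r ^ (-(2 * β)) = (r ^ 2) ^ (-β) := hpow u
  rw [this]
  simp only [Finset.sum_const, Finset.card_univ, Fintype.card_fin, nsmul_eq_mul]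
  nlinarith [mul_lt_mul_of_pos_left hmain hrp]

/-- The Riesz potential of a measure. -/
noncomputable def rieszPotential {d : ℕ} (α : ℝ) (m : Measure (EuclideanSpace ℝ (Fin d)))
    (x : EuclideanSpace ℝ (Fin d)) : ℝ≥0∞ :=
  ∫⁻ y, (edist x y) ^ (-α) ∂m

theorem measurable_edist_rpow {d : ℕ} (α : ℝ) (x : EuclideanSpace ℝ (Fin d)) :
    Measurable fun y => (edist x y) ^ (-α) := by
  fun_prop

theorem measurable_rieszPotential {d : ℕ} (α : ℝ) (m : Measure (EuclideanSpace ℝ (Fin d)))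
    [SFinite m] : Measurable (rieszPotential α m) := by
  unfold rieszPotential
  apply Measurable.lintegral_prod_right' (f := fun p : EuclideanSpace ℝ (Fin d) ×
    EuclideanSpace ℝ (Fin d) => (edist p.1 p.2) ^ (-α))
  fun_prop

theorem edist_rpow_neg_eq_ofReal {d : ℕ} {α : ℝ} {x y : EuclideanSpace ℝ (Fin d)}
    (h : 0 < ‖x - y‖) : (edist x y) ^ (-α) = ENNReal.ofReal (‖x - y‖ ^ (-α)) := by
  rw [edist_dist, dist_eq_norm, ENNReal.ofReal_rpow_of_pos h]

theorem edist_rpow_neg_le_ofReal {d : ℕ} {α ρ : ℝ} (hα : 0 < α) (hρ : 0 < ρ)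
    {x y : EuclideanSpace ℝ (Fin d)} (h : ρ ≤ dist x y) :
    (edist x y) ^ (-α) ≤ ENNReal.ofReal (ρ ^ (-α)) := by
  rw [dist_eq_norm] at h
  rw [edist_rpow_neg_eq_ofReal (hρ.trans_le h)]
  exact ENNReal.ofReal_le_ofReal (Real.rpow_le_rpow_of_nonpos hρ h (by linarith))

theorem ae_le_dist_of_measure_ball_eq_zero {d : ℕ} {m : Measure (EuclideanSpace ℝ (Fin d))}
    {x : EuclideanSpace ℝ (Fin d)} {r : ℝ} (h : m (ball x r) = 0) : ∀ᵐ y ∂m, r ≤ dist x y := by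
  filter_upwards [measure_eq_zero_iff_ae_notMem.1 h] with y hy
  simpa [dist_comm] using hy

theorem rieszPotential_le_of_measure_ball_eq_zero {d : ℕ} {α : ℝ} (hα : 0 < α)
    {m : Measure (EuclideanSpace ℝ (Fin d))} {x : EuclideanSpace ℝ (Fin d)} {r : ℝ} (hr : 0 < r)
    (h : m (ball x r) = 0) : rieszPotential α m x ≤ ENNReal.ofReal (r ^ (-α)) * m univ := by
  unfold rieszPotential
  rw [← lintegral_const]
  apply lintegral_mono_ae
  filter_upwards [ae_le_dist_of_measure_ball_eq_zero h] with y hy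
  exact edist_rpow_neg_le_ofReal hα hr hy

/-- A Riesz potential with `d < α + 2` has no local maximum off the support of the measure. -/
theorem exists_rieszPotential_lt {d : ℕ} {α : ℝ} (hα : 0 < α) (hd : (d : ℝ) < α + 2)
    (m : Measure (EuclideanSpace ℝ (Fin d))) [IsFiniteMeasure m] (hm : m ≠ 0)
    {x : EuclideanSpace ℝ (Fin d)} {r : ℝ} (hr : 0 < r) (hmx : m (ball x r) = 0) :
    ∃ y ∈ ball x r, rieszPotential α m x < rieszPotential α m y := by
  obtain ⟨h, hh0, -, hhr, hh⟩ := exists_lt_sum_norm_rpow_neg hα hd hr hr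
  set e : Fin d → EuclideanSpace ℝ (Fin d) := fun i => h • EuclideanSpace.single i (1 : ℝ) with he
  have hne : ∀ i, ‖e i‖ = h := fun i => by simp [he, norm_smul, abs_of_pos hh0]
  by_contra! hcon
  have hfin : rieszPotential α m x ≠ ⊤ := ne_top_of_le_ne_top
    (by finiteness) (rieszPotential_le_of_measure_ball_eq_zero hα hr hmx)
  have hle : ∑ i, (rieszPotential α m (x + e i) + rieszPotential α m (x - e i)) ≤
      2 * d * rieszPotential α m x := by
    calc _ ≤ ∑ i : Fin d, (rieszPotential α m x + rieszPotential α m x) := by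
          gcongr with i
          · exact hcon _ (by simp [hne, hhr])
          · exact hcon _ (by simp [hne, hhr])
      _ = _ := by simp; ring
  refine absurd hle (not_le.2 ?_)
  have hsum : ∑ i, (rieszPotential α m (x + e i) + rieszPotential α m (x - e i)) =
      ∫⁻ w, ∑ i, ((edist (x + e i) w) ^ (-α) + (edist (x - e i) w) ^ (-α)) ∂m := by
    rw [lintegral_finsetSum _ (fun i _ => by fun_prop)]
    congr 1 with i
    rw [lintegral_add_left (by fun_prop)]
    rfl
  have hx : 2 * d * rieszPotential α m x = ∫⁻ w, 2 * d * (edist x w) ^ (-α) ∂m := by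
    rw [lintegral_const_mul _ (by fun_prop)]
    rfl
  rw [hsum, hx]
  refine lintegral_strict_mono hm (by fun_prop) ?_ ?_
  · rw [← hx]; finiteness
  · filter_upwards [ae_le_dist_of_measure_ball_eq_zero hmx] with w hw
    rw [dist_eq_norm] at hw
    have hp : ∀ i, 0 < ‖x + e i - w‖ := fun i => by
      have := norm_sub_norm_le (x - w) (-e i)
      rw [norm_neg, hne] at this
      rw [show x + e i - w = x - w - -e i by abel]
      linarith
    have hq : ∀ i, 0 < ‖x - e i - w‖ := fun i => by
      have := norm_sub_norm_le (x - w) (e i)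
      rw [hne] at this
      rw [show x - e i - w = x - w - e i by abel]
      linarith
    have key := hh (x - w) hw
    rw [edist_rpow_neg_eq_ofReal (hr.trans_le hw)]
    simp_rw [fun i => edist_rpow_neg_eq_ofReal (α := α) (hp i),
      fun i => edist_rpow_neg_eq_ofReal (α := α) (hq i)]
    simp_rw [fun i => (ENNReal.ofReal_add (Real.rpow_nonneg (norm_nonneg (x + e i - w)) (-α))
      (Real.rpow_nonneg (norm_nonneg (x - e i - w)) (-α))).symm]
    rw [← ENNReal.ofReal_sum_of_nonneg (fun i _ => by positivity),
      show (2 * d : ℝ≥0∞) = ENNReal.ofReal (2 * d) by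
        rw [ENNReal.ofReal_mul (by norm_num)]; simp,
      ← ENNReal.ofReal_mul (by positivity)]
    rw [ENNReal.ofReal_lt_ofReal_iff_of_nonneg (by positivity)]
    simp_rw [fun i => show x + e i - w = x - w + e i by abel,
      fun i => show x - e i - w = x - w - e i by abel]
    exact key

theorem continuousAt_rieszPotential {d : ℕ} {α : ℝ} (hα : 0 < α)
    (m : Measure (EuclideanSpace ℝ (Fin d))) [IsFiniteMeasure m]
    {x : EuclideanSpace ℝ (Fin d)} {r : ℝ} (hr : 0 < r) (hmx : m (ball x r) = 0) :
    ContinuousAt (rieszPotential α m) x := by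
  refine tendsto_lintegral_filter_of_dominated_convergence
    (fun _ => ENNReal.ofReal ((r / 2) ^ (-α))) ?_ ?_ ?_ ?_
  · exact Eventually.of_forall fun y => by fun_prop
  · filter_upwards [ball_mem_nhds x (half_pos hr)] with y hy
    filter_upwards [ae_le_dist_of_measure_ball_eq_zero hmx] with w hw
    refine edist_rpow_neg_le_ofReal hα (half_pos hr) ?_
    rw [mem_ball] at hy
    have := dist_triangle x y w
    rw [dist_comm x y] at this
    linarith
  · rw [lintegral_const]; finiteness
  · refine Eventually.of_forall fun w => ?_
    exact ((ENNReal.continuous_rpow_const (y := -α)).comp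
      (continuous_id.edist continuous_const)).continuousAt

theorem lowerSemicontinuous_rieszPotential {d : ℕ} (α : ℝ)
    (m : Measure (EuclideanSpace ℝ (Fin d))) : LowerSemicontinuous (rieszPotential α m) := by
  rw [lowerSemicontinuous_iff_le_liminf]
  intro x
  refine le_trans (lintegral_mono fun w => ?_) (lintegral_liminf_le fun y => by fun_prop)
  have : Tendsto (fun y => (edist y w) ^ (-α)) (nhds x) (nhds ((edist x w) ^ (-α))) :=
    ((ENNReal.continuous_rpow_const (y := -α)).comp
      (continuous_id.edist continuous_const)).continuousAt
  exact this.liminf_eq.ge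

theorem lintegral_rieszPotential_comm {d : ℕ} (α : ℝ)
    (m n : Measure (EuclideanSpace ℝ (Fin d))) [SFinite m] [SFinite n] :
    ∫⁻ x, rieszPotential α m x ∂n = ∫⁻ x, rieszPotential α n x ∂m := by
  unfold rieszPotential
  rw [lintegral_lintegral_swap (by fun_prop)]
  simp_rw [edist_comm]

theorem rieszEnergyOf_add_smul {d : ℕ} (α : ℝ) (m n : Measure (EuclideanSpace ℝ (Fin d)))
    [SFinite m] [SFinite n] (a b : ℝ≥0∞) :
    rieszEnergyOf α (a • m + b • n) = a * a * rieszEnergyOf α m +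
      2 * a * b * ∫⁻ x, rieszPotential α m x ∂n + b * b * rieszEnergyOf α n := by
  have hpot : ∀ x, ∫⁻ y, (edist x y) ^ (-α) ∂(a • m + b • n) =
      a * rieszPotential α m x + b * rieszPotential α n x := fun x => by
    rw [lintegral_add_measure, lintegral_smul_measure, lintegral_smul_measure]
    rfl
  have hm := measurable_rieszPotential α m
  have hn := measurable_rieszPotential α n
  have e : ∀ k : Measure (EuclideanSpace ℝ (Fin d)),
      rieszEnergyOf α k = ∫⁻ x, rieszPotential α k x ∂k := fun _ => rfl
  rw [rieszEnergyOf]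
  simp_rw [hpot]
  rw [lintegral_add_measure, lintegral_smul_measure, lintegral_smul_measure,
    lintegral_add_left (by fun_prop), lintegral_add_left (by fun_prop),
    lintegral_const_mul _ hm, lintegral_const_mul _ hn, lintegral_const_mul _ hm,
    lintegral_const_mul _ hn, lintegral_rieszPotential_comm α n m, e m, e n]
  simp only [smul_eq_mul]
  ring

theorem rieszEnergyOf_mono {d : ℕ} (α : ℝ) {m n : Measure (EuclideanSpace ℝ (Fin d))}
    (h : m ≤ n) : rieszEnergyOf α m ≤ rieszEnergyOf α n :=
  lintegral_mono' h fun _ => lintegral_mono' h le_rfl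

theorem rieszEnergyOf_smul {d : ℕ} (α : ℝ) (c : ℝ≥0∞) (m : Measure (EuclideanSpace ℝ (Fin d)))
    [SFinite m] : rieszEnergyOf α (c • m) = c * c * rieszEnergyOf α m := by
  simpa using rieszEnergyOf_add_smul α m m c 0

theorem rieszEnergyOf_cond_ne_top {d : ℕ} {α : ℝ} {m : Measure (EuclideanSpace ℝ (Fin d))}
    [IsFiniteMeasure m] (hm : rieszEnergyOf α m ≠ ⊤) {s : Set (EuclideanSpace ℝ (Fin d))}
    (hs : m s ≠ 0) : rieszEnergyOf α (ProbabilityTheory.cond m s) ≠ ⊤ := by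
  rw [ProbabilityTheory.cond, rieszEnergyOf_smul]
  have h1 : rieszEnergyOf α (m.restrict s) ≠ ⊤ :=
    ne_top_of_le_ne_top hm (rieszEnergyOf_mono α Measure.restrict_le_self)
  have h2 : (m s)⁻¹ ≠ ⊤ := ENNReal.inv_ne_top.2 hs
  finiteness

theorem rieszEnergy_le {d : ℕ} {α : ℝ} {A : Set (EuclideanSpace ℝ (Fin d))}
    (σ : Measure (EuclideanSpace ℝ (Fin d))) [h : IsProbabilityMeasure σ] (hσ : σ A = 1) :
    rieszEnergy α A ≤ rieszEnergyOf α σ :=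
  iInf₂_le σ ⟨h, hσ⟩

/-- First variation of the energy at a minimizer. -/
theorem rieszEnergyOf_le_lintegral_rieszPotential {d : ℕ} {α : ℝ}
    {A : Set (EuclideanSpace ℝ (Fin d))} (μ σ : Measure (EuclideanSpace ℝ (Fin d)))
    [IsProbabilityMeasure μ] [IsProbabilityMeasure σ] (hμ : μ A = 1) (hσ : σ A = 1)
    (hmin : rieszEnergyOf α μ = rieszEnergy α A) (hfin : rieszEnergyOf α σ ≠ ⊤) :
    rieszEnergyOf α μ ≤ ∫⁻ x, rieszPotential α μ x ∂σ := by
  by_contra! hlt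
  have hI : rieszEnergyOf α μ ≠ ⊤ := ne_top_of_le_ne_top hfin (hmin ▸ rieszEnergy_le σ hσ)
  have hineq : ∀ t : ℝ, 0 ≤ t → t ≤ 1 → rieszEnergyOf α μ ≤
      ENNReal.ofReal (1 - t) * ENNReal.ofReal (1 - t) * rieszEnergyOf α μ +
      2 * ENNReal.ofReal (1 - t) * ENNReal.ofReal t * ∫⁻ x, rieszPotential α μ x ∂σ +
      ENNReal.ofReal t * ENNReal.ofReal t * rieszEnergyOf α σ := by
    intro t h0 h1
    have hsum : ENNReal.ofReal (1 - t) + ENNReal.ofReal t = 1 := by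
      rw [← ENNReal.ofReal_add (by linarith) h0]; simp
    have : IsProbabilityMeasure (ENNReal.ofReal (1 - t) • μ + ENNReal.ofReal t • σ) :=
      ⟨by simpa using hsum⟩
    rw [← rieszEnergyOf_add_smul]
    conv_lhs => rw [hmin]
    exact rieszEnergy_le _ (by simpa [hμ, hσ] using hsum)
  set J := ∫⁻ x, rieszPotential α μ x ∂σ
  have hJ : J ≠ ⊤ := ne_top_of_lt hlt
  obtain ⟨a, ha, hIa⟩ : ∃ a : ℝ, 0 ≤ a ∧ rieszEnergyOf α μ = ENNReal.ofReal a :=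
    ⟨_, ENNReal.toReal_nonneg, (ENNReal.ofReal_toReal hI).symm⟩
  obtain ⟨b, hb, hJb⟩ : ∃ b : ℝ, 0 ≤ b ∧ J = ENNReal.ofReal b :=
    ⟨_, ENNReal.toReal_nonneg, (ENNReal.ofReal_toReal hJ).symm⟩
  obtain ⟨s, hs, hSs⟩ : ∃ s : ℝ, 0 ≤ s ∧ rieszEnergyOf α σ = ENNReal.ofReal s :=
    ⟨_, ENNReal.toReal_nonneg, (ENNReal.ofReal_toReal hfin).symm⟩
  rw [hIa, hJb, hSs] at hineq
  rw [hIa, hJb, ENNReal.ofReal_lt_ofReal_iff_of_nonneg hb] at hlt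
  have hreal : ∀ t : ℝ, 0 ≤ t → t ≤ 1 →
      a ≤ (1 - t) * (1 - t) * a + 2 * (1 - t) * t * b + t * t * s := by
    intro t h0 h1
    have h1' : 0 ≤ 1 - t := by linarith
    have := hineq t h0 h1
    rwa [show (2 : ℝ≥0∞) = ENNReal.ofReal 2 by simp, ← ENNReal.ofReal_mul (by positivity),
      ← ENNReal.ofReal_mul (by positivity), ← ENNReal.ofReal_mul (by positivity),
      ← ENNReal.ofReal_mul (by positivity), ← ENNReal.ofReal_mul (by positivity),
      ← ENNReal.ofReal_mul (by positivity), ← ENNReal.ofReal_mul (by positivity),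
      ← ENNReal.ofReal_add (by positivity) (by positivity),
      ← ENNReal.ofReal_add (by positivity) (by positivity),
      ENNReal.ofReal_le_ofReal_iff (by positivity)] at this
  have hc : 0 < a + s + 1 := by positivity
  set t := (a - b) / (a + s + 1) with ht
  have ht0 : 0 < t := div_pos (by linarith) hc
  have ht1 : t ≤ 1 := (div_le_one hc).2 (by linarith)
  have htc : t * (a + s + 1) = a - b := div_mul_cancel₀ _ hc.ne'
  have := hreal t ht0.le ht1
  have h2 : 0 ≤ t * (t * (a + s) - 2 * (t * (a + s + 1)) - 2 * t * b) := by
    have : a - b = t * (a + s + 1) := htc.symm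
    nlinarith
  have h3 := nonneg_of_mul_nonneg_right h2 ht0
  nlinarith [mul_nonneg ht0.le ha, mul_nonneg ht0.le hb, mul_nonneg ht0.le hs]

theorem measure_rieszPotential_lt_eq_zero {d : ℕ} {α : ℝ}
    {A : Set (EuclideanSpace ℝ (Fin d))} (hA : MeasurableSet A)
    (μ σ : Measure (EuclideanSpace ℝ (Fin d)))
    [IsProbabilityMeasure μ] [IsFiniteMeasure σ] (hμ : μ A = 1) (hσ : σ Aᶜ = 0)
    (hmin : rieszEnergyOf α μ = rieszEnergy α A) (hfin : rieszEnergyOf α σ ≠ ⊤) :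
    σ {x | rieszPotential α μ x < rieszEnergyOf α μ} = 0 := by
  by_contra hpos
  have hmeas : MeasurableSet {x | rieszPotential α μ x < rieszEnergyOf α μ} :=
    measurableSet_lt (measurable_rieszPotential α μ) measurable_const
  have hprob := ProbabilityTheory.cond_isProbabilityMeasure hpos
  set τ := ProbabilityTheory.cond σ {x | rieszPotential α μ x < rieszEnergyOf α μ}
  have hτA : τ A = 1 :=
    (prob_compl_eq_zero_iff hA).1 (ProbabilityTheory.cond_absolutelyContinuous hσ)
  have hτfin : rieszEnergyOf α τ ≠ ⊤ := rieszEnergyOf_cond_ne_top hfin hpos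
  have hI : rieszEnergyOf α μ ≠ ⊤ := ne_top_of_le_ne_top hτfin (hmin ▸ rieszEnergy_le τ hτA)
  have hle := rieszEnergyOf_le_lintegral_rieszPotential μ τ hμ hτA hmin hτfin
  have hae : ∀ᵐ x ∂τ, rieszPotential α μ x < rieszEnergyOf α μ :=
    ProbabilityTheory.ae_cond_of_forall_mem hmeas fun x hx => hx
  have hle' : ∫⁻ x, rieszPotential α μ x ∂τ ≤ rieszEnergyOf α μ := by
    calc _ ≤ ∫⁻ _, rieszEnergyOf α μ ∂τ := lintegral_mono_ae (hae.mono fun x hx => hx.le)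
      _ = _ := by simp
  have := lintegral_strict_mono (IsProbabilityMeasure.ne_zero τ) aemeasurable_const
    (ne_top_of_le_ne_top hI hle') hae
  simp only [lintegral_const, measure_univ, mul_one] at this
  exact absurd hle (not_le.2 this)

theorem ae_rieszPotential_eq {d : ℕ} {α : ℝ}
    {A : Set (EuclideanSpace ℝ (Fin d))} (hA : MeasurableSet A)
    (μ : Measure (EuclideanSpace ℝ (Fin d))) [IsProbabilityMeasure μ] (hμ : μ A = 1)
    (hmin : rieszEnergyOf α μ = rieszEnergy α A) (hfin : rieszEnergyOf α μ ≠ ⊤) :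
    ∀ᵐ x ∂μ, rieszPotential α μ x = rieszEnergyOf α μ := by
  have h0 := measure_rieszPotential_lt_eq_zero hA μ μ hμ ((prob_compl_eq_zero_iff hA).2 hμ)
    hmin hfin
  have hle : (fun _ => rieszEnergyOf α μ) ≤ᵐ[μ] rieszPotential α μ := by
    filter_upwards [measure_eq_zero_iff_ae_notMem.1 h0] with x hx
    simpa using hx
  have := ae_eq_of_ae_le_of_lintegral_le hle (by simpa using hfin)
    (measurable_rieszPotential α μ).aemeasurable (by simp; rfl)
  filter_upwards [this] with x hx
  exact hx.symm

theorem rieszEnergyOf_volume_restrict_ne_top {d : ℕ} (hd : 1 ≤ d) {α : ℝ}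
    (hαd : α < d) {E : Set (EuclideanSpace ℝ (Fin d))} (hE : Bornology.IsBounded E)
    (hEm : MeasurableSet E) :
    rieszEnergyOf α ((volume : Measure (EuclideanSpace ℝ (Fin d))).restrict E) ≠ ⊤ := by
  obtain ⟨R, hR⟩ := hE.subset_ball 0
  have hInt : IntegrableOn (fun x : EuclideanSpace ℝ (Fin d) => ‖x‖ ^ (-α))
      (ball 0 (2 * R)) volume := by
    refine integrableOn_ball_of_norm_le_rpow (C := 1) (α := α) (by simpa using hd)
      (by simpa using hαd) (Eventually.of_forall fun x => ?_)
      (by measurability : Measurable _).aestronglyMeasurable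
    simp [abs_of_nonneg (Real.rpow_nonneg (norm_nonneg x) _)]
  have hlt := hInt.lintegral_lt_top
  have : Nonempty (Fin d) := ⟨⟨0, hd⟩⟩
  set C := ∫⁻ x in ball (0 : EuclideanSpace ℝ (Fin d)) (2 * R), ENNReal.ofReal (‖x‖ ^ (-α)) with hC
  have hpot : ∀ x ∈ E, ∫⁻ y in E, (edist x y) ^ (-α) ≤ C := by
    intro x hx
    rw [hC, ← lintegral_indicator hEm, ← lintegral_indicator measurableSet_ball,
      ← lintegral_sub_left_eq_self ((ball 0 (2 * R)).indicator _) x]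
    apply lintegral_mono_ae
    have hne : ∀ᵐ y : EuclideanSpace ℝ (Fin d), y ≠ x := by
      simp [ae_iff]
    filter_upwards [hne] with y hy
    by_cases hyE : y ∈ E
    · have h1 := mem_ball_zero_iff.1 (hR hx)
      have h2 := mem_ball_zero_iff.1 (hR hyE)
      have h3 : x - y ∈ ball (0 : EuclideanSpace ℝ (Fin d)) (2 * R) := by
        rw [mem_ball_zero_iff]
        linarith [norm_sub_le x y]
      rw [indicator_of_mem hyE, indicator_of_mem h3,
        edist_rpow_neg_eq_ofReal (norm_pos_iff.2 (sub_ne_zero.2 hy.symm))]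
    · rw [indicator_of_notMem hyE]; exact zero_le
  have hvol : volume E ≠ ⊤ := hE.measure_lt_top.ne
  refine ne_top_of_le_ne_top (b := C * volume E) (by finiteness) ?_
  calc _ ≤ ∫⁻ _ in E, C := setLIntegral_mono measurable_const hpot
    _ = _ := by simp

theorem rieszPotential_add_measure {d : ℕ} (α : ℝ) (m n : Measure (EuclideanSpace ℝ (Fin d)))
    (x : EuclideanSpace ℝ (Fin d)) :
    rieszPotential α (m + n) x = rieszPotential α m x + rieszPotential α n x :=
  lintegral_add_measure _ _ _

theorem rieszPotential_le_two_rpow_mul {d : ℕ} {α : ℝ} (hα : 0 < α)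
    {m : Measure (EuclideanSpace ℝ (Fin d))} {K : Set (EuclideanSpace ℝ (Fin d))}
    (hm : m Kᶜ = 0) {x y : EuclideanSpace ℝ (Fin d)} (hxy : ∀ w ∈ K, edist x y ≤ edist x w) :
    rieszPotential α m x ≤ 2 ^ α * rieszPotential α m y := by
  unfold rieszPotential
  rw [← lintegral_const_mul _ (by fun_prop)]
  apply lintegral_mono_ae
  filter_upwards [measure_eq_zero_iff_ae_notMem.1 hm] with w hw
  have hle : edist y w ≤ 2 * edist x w := by
    calc edist y w ≤ edist y x + edist x w := edist_triangle _ _ _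
      _ ≤ edist x w + edist x w := by
          rw [edist_comm y x]; gcongr; exact hxy w (by simpa using hw)
      _ = _ := by ring
  have hk0 : (2 : ℝ≥0∞) ^ α ≠ 0 := by simp [ENNReal.rpow_eq_zero_iff]
  have hkt : (2 : ℝ≥0∞) ^ α ≠ ⊤ := by simp [ENNReal.rpow_eq_top_iff]
  have h1 : (edist y w) ^ α ≤ 2 ^ α * (edist x w) ^ α := by
    rw [← ENNReal.mul_rpow_of_nonneg _ _ hα.le]
    exact ENNReal.rpow_le_rpow hle hα.le
  rw [ENNReal.rpow_neg, ENNReal.rpow_neg]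
  calc ((edist x w) ^ α)⁻¹ = 2 ^ α * (2 ^ α * (edist x w) ^ α)⁻¹ := by
        rw [ENNReal.mul_inv (Or.inl hk0) (Or.inl hkt), ← mul_assoc,
          ENNReal.mul_inv_cancel hk0 hkt, one_mul]
    _ ≤ _ := by gcongr

theorem exists_rieszPotential_restrict_ball_lt {d : ℕ} {α : ℝ} (hα : 0 < α)
    {m : Measure (EuclideanSpace ℝ (Fin d))} [IsFiniteMeasure m] {x : EuclideanSpace ℝ (Fin d)}
    (hx : rieszPotential α m x ≠ ⊤) {ε : ℝ≥0∞} (hε : ε ≠ 0) :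
    ∃ δ > 0, rieszPotential α (m.restrict (ball x δ)) x < ε := by
  obtain ⟨η, hη, hs⟩ := exists_pos_setLIntegral_lt_of_measure_lt hx hε
  have hmx : m {x} = 0 := by
    refine measure_mono_null (fun y hy => ?_) (ae_lt_top (measurable_edist_rpow α x) hx)
    rw [mem_singleton_iff.1 hy]
    simp [hα]
  obtain ⟨U, hU, hUo, hUm⟩ := ({x} : Set (EuclideanSpace ℝ (Fin d))).exists_isOpen_lt_of_lt η
    (by rw [hmx]; exact hη)
  obtain ⟨δ, hδ, hball⟩ := Metric.isOpen_iff.1 hUo x (hU rfl)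
  exact ⟨δ, hδ, hs _ ((measure_mono hball).trans_lt hUm)⟩

theorem exists_measure_ball_eq_zero {d : ℕ} {m : Measure (EuclideanSpace ℝ (Fin d))}
    {K : Set (EuclideanSpace ℝ (Fin d))} (hK : IsClosed K) (hm : m Kᶜ = 0)
    {x : EuclideanSpace ℝ (Fin d)} (hx : x ∉ K) : ∃ r > 0, m (ball x r) = 0 := by
  obtain ⟨r, hr, hball⟩ := Metric.isOpen_iff.1 hK.isOpen_compl x hx
  exact ⟨r, hr, measure_mono_null hball hm⟩

/-- Continuity principle: a potential that adds up with another one to a constant on a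
compact set carrying the measure is upper semicontinuous everywhere. -/
theorem upperSemicontinuous_rieszPotential {d : ℕ} {α : ℝ} (hα : 0 < α)
    (m n : Measure (EuclideanSpace ℝ (Fin d))) [IsFiniteMeasure m]
    {K : Set (EuclideanSpace ℝ (Fin d))} (hK : IsCompact K) (hm : m Kᶜ = 0) {c : ℝ≥0∞}
    (hc : c ≠ ⊤) (hmn : ∀ x ∈ K, rieszPotential α m x + rieszPotential α n x = c) :
    UpperSemicontinuous (rieszPotential α m) := by
  intro y
  by_cases hy : y ∉ K
  · obtain ⟨r, hr, hball⟩ := exists_measure_ball_eq_zero hK.isClosed hm hy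
    exact (continuousAt_rieszPotential hα m hr hball).upperSemicontinuousAt
  push Not at hy
  intro b hb
  have hytop : rieszPotential α m y ≠ ⊤ :=
    ne_top_of_le_ne_top hc ((hmn y hy) ▸ le_self_add)
  obtain ⟨r, hr, hrb⟩ := ENNReal.lt_iff_exists_add_pos_lt.1 hb
  have hr0 : (r : ℝ≥0∞) ≠ 0 := by exact_mod_cast hr.ne'
  have hk0 : (2 : ℝ≥0∞) ^ α ≠ 0 := by simp [ENNReal.rpow_eq_zero_iff]
  have hkt : (2 : ℝ≥0∞) ^ α ≠ ⊤ := by simp [ENNReal.rpow_eq_top_iff]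
  set ε : ℝ≥0∞ := (r / 2) / 2 ^ α with hεdef
  have hε0 : ε ≠ 0 := ENNReal.div_ne_zero.2 ⟨ENNReal.div_ne_zero.2 ⟨hr0, by simp⟩, hkt⟩
  have hkε : 2 ^ α * ε = r / 2 := ENNReal.mul_div_cancel hk0 hkt
  obtain ⟨δ, hδ, hnear⟩ := exists_rieszPotential_restrict_ball_lt hα hytop hε0
  set N := m.restrict (ball y δ)
  set F := m.restrict (ball y δ)ᶜ
  have hmNF : m = N + F := (Measure.restrict_add_restrict_compl measurableSet_ball).symm
  have hsplit : ∀ x, rieszPotential α m x = rieszPotential α N x + rieszPotential α F x :=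
    fun x => by rw [← rieszPotential_add_measure, ← hmNF]
  have hsum : ∀ x ∈ K, rieszPotential α N x + rieszPotential α (F + n) x = c := fun x hx => by
    rw [rieszPotential_add_measure, ← add_assoc, ← hsplit, hmn x hx]
  have hlsc : LowerSemicontinuous fun x => rieszPotential α (F + n) x + ε :=
    (lowerSemicontinuous_rieszPotential α (F + n)).add lowerSemicontinuous_const
  have hlt : c < rieszPotential α (F + n) y + ε := by
    rw [← hsum y hy, add_comm]
    refine ENNReal.add_lt_add_left ?_ hnear
    exact ne_top_of_le_ne_top hc ((hsum y hy) ▸ le_add_self)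
  obtain ⟨η, hη, hηball⟩ := Metric.eventually_nhds_iff_ball.1 (hlsc y c hlt)
  have hNK : ∀ x ∈ K, x ∈ ball y η → rieszPotential α N x < ε := by
    intro x hx hxη
    have h1 := hηball x hxη
    rw [← hsum x hx, add_comm (rieszPotential α N x)] at h1
    exact lt_of_add_lt_add_left h1
  have hFtop : rieszPotential α F y ≠ ⊤ :=
    ne_top_of_le_ne_top hytop ((hsplit y) ▸ le_add_self)
  have hFball : F (ball y δ) = 0 := by
    simp [F, Measure.restrict_apply measurableSet_ball]
  have hFev : ∀ᶠ x in nhds y, rieszPotential α F x < rieszPotential α F y + r / 2 :=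
    (continuousAt_rieszPotential hα F hδ hFball).eventually (gt_mem_nhds
      (ENNReal.lt_add_right hFtop (ENNReal.div_ne_zero.2 ⟨hr0, by simp⟩)))
  filter_upwards [hFev, ball_mem_nhds y (half_pos hη)] with x hxF hxη
  obtain ⟨z, hz, hzx⟩ := hK.exists_infDist_eq_dist ⟨y, hy⟩ x
  have hnearest : ∀ w ∈ K, dist x z ≤ dist x w := fun w hw =>
    hzx ▸ infDist_le_dist_of_mem hw
  have hzη : z ∈ ball y η := by
    rw [mem_ball] at hxη ⊢
    have h1 := hnearest y hy
    have h2 := dist_triangle z x y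
    rw [dist_comm z x] at h2
    linarith
  have hNx : rieszPotential α N x ≤ r / 2 := by
    rw [← hkε]
    refine (rieszPotential_le_two_rpow_mul hα (K := K)
      (Measure.restrict_le_self.absolutelyContinuous hm) (y := z) fun w hw => ?_).trans ?_
    · rw [edist_dist, edist_dist]
      exact ENNReal.ofReal_le_ofReal (hnearest w hw)
    · gcongr
      exact (hNK z hz hzη).le
  calc rieszPotential α m x = rieszPotential α N x + rieszPotential α F x := hsplit x
    _ ≤ r / 2 + (rieszPotential α F y + r / 2) := by gcongr
    _ = rieszPotential α F y + r := by
        rw [add_left_comm, ENNReal.add_halves]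
    _ ≤ rieszPotential α m y + r := by
        gcongr; rw [hsplit y]; exact le_add_self
    _ < b := hrb

theorem tendsto_rieszPotential_cocompact {d : ℕ} {α : ℝ} (hα : 0 < α)
    (m : Measure (EuclideanSpace ℝ (Fin d))) [IsFiniteMeasure m]
    {K : Set (EuclideanSpace ℝ (Fin d))} (hK : Bornology.IsBounded K) (hm : m Kᶜ = 0) :
    Tendsto (rieszPotential α m) (cocompact _) (nhds 0) := by
  obtain ⟨R, hR⟩ := hK.subset_ball 0
  have hreal : Tendsto (fun x : EuclideanSpace ℝ (Fin d) => ENNReal.ofReal ((‖x‖ - R) ^ (-α)) *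
      m univ) (cocompact _) (nhds 0) := by
    have h1 : Tendsto (fun x : EuclideanSpace ℝ (Fin d) => (‖x‖ - R) ^ (-α)) (cocompact _)
        (nhds 0) := (tendsto_rpow_neg_atTop hα).comp
          (tendsto_atTop_add_const_right _ (-R) tendsto_norm_cocompact_atTop)
    have h2 := ENNReal.Tendsto.mul_const (ENNReal.tendsto_ofReal h1)
      (Or.inr (measure_ne_top m univ))
    simpa using h2
  refine tendsto_of_tendsto_of_tendsto_of_le_of_le' tendsto_const_nhds hreal
    (Eventually.of_forall fun _ => zero_le) ?_
  filter_upwards [tendsto_norm_cocompact_atTop.eventually_gt_atTop R] with x hx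
  refine rieszPotential_le_of_measure_ball_eq_zero hα (sub_pos.2 hx) (measure_mono_null ?_ hm)
  intro w hw hwK
  have h1 := mem_ball_zero_iff.1 (hR hwK)
  rw [mem_ball, dist_eq_norm] at hw
  have h2 := norm_sub_norm_le x w
  rw [norm_sub_rev] at h2
  linarith

/-- Maximum principle for Riesz potentials. -/
theorem rieszPotential_le_of_add_eq {d : ℕ} {α : ℝ} (hα : 0 < α) (hd : (d : ℝ) < α + 2)
    (m n : Measure (EuclideanSpace ℝ (Fin d))) [IsFiniteMeasure m]
    {K : Set (EuclideanSpace ℝ (Fin d))} (hK : IsCompact K) (hm : m Kᶜ = 0) {c : ℝ≥0∞}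
    (hc : c ≠ ⊤) (hmn : ∀ x ∈ K, rieszPotential α m x + rieszPotential α n x = c)
    (x : EuclideanSpace ℝ (Fin d)) : rieszPotential α m x ≤ c := by
  by_contra! hx
  have husc := upperSemicontinuous_rieszPotential hα m n hK hm hc hmn
  have hev := (tendsto_rieszPotential_cocompact hα m hK.isBounded hm).eventually
    (gt_mem_nhds (zero_le.trans_lt hx))
  obtain ⟨L, hL, hLsub⟩ := mem_cocompact.1 hev
  have hxL : x ∈ L := by
    by_contra h
    exact lt_irrefl (rieszPotential α m x) (hLsub h)
  obtain ⟨z, hz, hmax⟩ := (husc.upperSemicontinuousOn L).exists_isMaxOn ⟨x, hxL⟩ hL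
  have hglob : ∀ w, rieszPotential α m w ≤ rieszPotential α m z := by
    intro w
    by_cases hw : w ∈ L
    · exact hmax hw
    · exact (show rieszPotential α m w < _ from hLsub hw).le.trans (hmax hxL)
  have hcz : c < rieszPotential α m z := hx.trans_le (hmax hxL)
  have hzK : z ∉ K := fun h => not_le.2 hcz ((hmn z h) ▸ le_self_add)
  have hm0 : m ≠ 0 := by
    rintro rfl
    simp [rieszPotential] at hcz
  obtain ⟨r, hr, hball⟩ := exists_measure_ball_eq_zero hK.isClosed hm hzK
  obtain ⟨w, -, hw⟩ := exists_rieszPotential_lt hα hd m hm0 hr hball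
  exact not_le.2 hw (hglob w)

theorem rieszPotential_le_of_ae_eq {d : ℕ} {α : ℝ} (hα : 0 < α) (hd : (d : ℝ) < α + 2)
    (μ : Measure (EuclideanSpace ℝ (Fin d))) [IsFiniteMeasure μ] {c : ℝ≥0∞} (hc : c ≠ ⊤)
    (hμ : ∀ᵐ x ∂μ, rieszPotential α μ x = c) {x : EuclideanSpace ℝ (Fin d)} {r : ℝ}
    (hr : 0 < r) (hball : μ (ball x r) = 0) : rieszPotential α μ x ≤ c := by
  set C : ℝ≥0∞ := ENNReal.ofReal (r ^ (-α)) with hC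
  have hC0 : C ≠ 0 := by
    rw [hC]; simpa using Real.rpow_pos_of_pos hr _
  have hCt : C ≠ ⊤ := ENNReal.ofReal_ne_top
  refine ENNReal.le_of_forall_pos_le_add fun ε hε _ => ?_
  set G := {x | rieszPotential α μ x = c} with hG
  have hGm : MeasurableSet G := measurable_rieszPotential α μ (measurableSet_singleton c)
  obtain ⟨K, hKG, hK, hKlt⟩ := hGm.exists_isCompact_lt_add (measure_ne_top μ G)
    (ε := ε / C) (ENNReal.div_ne_zero.2 ⟨by exact_mod_cast hε.ne', hCt⟩)
  have hKc : μ Kᶜ ≤ ε / C := by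
    rw [measure_compl hK.measurableSet (measure_ne_top μ K), tsub_le_iff_left]
    have : μ univ = μ G := (measure_congr (eventuallyEq_univ.2 hμ)).symm
    rw [this]
    exact hKlt.le
  have hsplit : μ = μ.restrict K + μ.restrict Kᶜ :=
    (Measure.restrict_add_restrict_compl hK.measurableSet).symm
  have hpot : ∀ y, rieszPotential α μ y =
      rieszPotential α (μ.restrict K) y + rieszPotential α (μ.restrict Kᶜ) y := fun y => by
    rw [← rieszPotential_add_measure, ← hsplit]
  rw [hpot]
  gcongr
  · refine rieszPotential_le_of_add_eq hα hd _ (μ.restrict Kᶜ) hK ?_ hc (fun y hy => ?_) x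
    · simp [Measure.restrict_apply hK.measurableSet.compl]
    · rw [← hpot]; exact hKG hy
  · refine (rieszPotential_le_of_measure_ball_eq_zero hα hr
      (Measure.restrict_le_self.absolutelyContinuous hball)).trans ?_
    rw [Measure.restrict_apply_univ, ← ENNReal.mul_div_cancel (a := C) (b := ε) hC0 hCt]
    gcongr

theorem measure_ball_ne_zero_of_minimizer {d : ℕ} {α : ℝ} (hα : 0 < α) (hd : (d : ℝ) < α + 2)
    (hd1 : 1 ≤ d) (hαd : α < d) {A : Set (EuclideanSpace ℝ (Fin d))} (hA : MeasurableSet A)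
    (hAb : Bornology.IsBounded A) (μ : Measure (EuclideanSpace ℝ (Fin d)))
    [IsProbabilityMeasure μ] (hμ : μ A = 1) (hmin : rieszEnergyOf α μ = rieszEnergy α A)
    {z : EuclideanSpace ℝ (Fin d)} {r : ℝ} (hr : 0 < r) (hzA : ball z r ⊆ A) :
    μ (ball z r) ≠ 0 := by
  intro hball
  have hσfin := rieszEnergyOf_volume_restrict_ne_top hd1 hαd hAb hA
  set σ := (volume : Measure (EuclideanSpace ℝ (Fin d))).restrict A with hσ
  have : IsFiniteMeasure σ := ⟨by rw [hσ, Measure.restrict_apply_univ]; exact hAb.measure_lt_top⟩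
  have hσA : σ Aᶜ = 0 := by simp [hσ, Measure.restrict_apply hA.compl]
  have hσball : ∀ {s : ℝ}, 0 < s → s ≤ r → σ (ball z s) ≠ 0 := fun {s} hs hsr => by
    rw [hσ, Measure.restrict_apply measurableSet_ball,
      inter_eq_left.2 ((ball_subset_ball hsr).trans hzA)]
    exact (measure_ball_pos volume z hs).ne'
  have hI : rieszEnergyOf α μ ≠ ⊤ := by
    have hσ0 : σ A ≠ 0 := fun h => hσball hr le_rfl (measure_mono_null hzA h)
    have := ProbabilityTheory.cond_isProbabilityMeasure hσ0
    exact ne_top_of_le_ne_top (rieszEnergyOf_cond_ne_top hσfin hσ0) (hmin ▸ rieszEnergy_le _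
      ((prob_compl_eq_zero_iff hA).1 (ProbabilityTheory.cond_absolutelyContinuous hσA)))
  have hnull := measure_rieszPotential_lt_eq_zero hA μ σ hμ hσA hmin hσfin
  have hae := ae_rieszPotential_eq hA μ hμ hmin hI
  obtain ⟨x, hx, hxI⟩ : ∃ x ∈ ball z (r / 2), rieszEnergyOf α μ ≤ rieszPotential α μ x := by
    by_contra! h
    exact hσball (half_pos hr) (by linarith) (measure_mono_null h hnull)
  have hsub : ∀ y ∈ ball x (r / 4), ball y (r / 4) ⊆ ball z r := fun y hy =>
    ball_subset_ball' (by
      have := dist_triangle y x z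
      rw [mem_ball] at hx hy
      linarith)
  have hr4 : 0 < r / 4 := by linarith
  obtain ⟨y, hy, hxy⟩ := exists_rieszPotential_lt hα hd μ (IsProbabilityMeasure.ne_zero μ) hr4
    (measure_mono_null (hsub x (mem_ball_self hr4)) hball)
  exact not_le.2 (hxI.trans_lt hxy)
    (rieszPotential_le_of_ae_eq hα hd μ hI hae hr4 (measure_mono_null (hsub y hy) hball))

/-- For `α ∈ (d-2, d)` the minimizing measure of the Riesz energy of a bounded open set
has support equal to the closure of the set. -/
theorem support_eq_closure_of_minimizer {d : ℕ} (hd : 3 ≤ d) (α : ℝ)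
    (hα1 : (d : ℝ) - 2 < α) (hα2 : α < d)
    (E : Set (EuclideanSpace ℝ (Fin d))) (hE : IsOpen E)
    (hEb : Bornology.IsBounded E) (hEne : E.Nonempty)
    (μ : Measure (EuclideanSpace ℝ (Fin d))) [IsProbabilityMeasure μ]
    (hμE : μ (closure E) = 1)
    (hmin : rieszEnergyOf α μ = rieszEnergy α (closure E)) :
    msupport μ = closure E := by
  have hd3 : (3 : ℝ) ≤ d := by exact_mod_cast hd
  apply Subset.antisymm
  · intro x hx
    by_contra hxE
    exact (hx _ (isClosed_closure.isOpen_compl.mem_nhds hxE)).ne'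
      ((prob_compl_eq_zero_iff isClosed_closure.measurableSet).2 hμE)
  · intro x hx U hU
    obtain ⟨V, hVU, hV, hxV⟩ := _root_.mem_nhds_iff.1 hU
    obtain ⟨z, hzV, hzE⟩ := mem_closure_iff.1 hx V hV hxV
    obtain ⟨r, hr, hball⟩ := Metric.isOpen_iff.1 (hV.inter hE) z ⟨hzV, hzE⟩
    have hne := measure_ball_ne_zero_of_minimizer (by linarith) (by linarith) (by omega) hα2
      isClosed_closure.measurableSet hEb.closure μ hμE hmin hr
      (hball.trans (inter_subset_right.trans subset_closure))
    exact (pos_iff_ne_zero.2 hne).trans_le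
      (measure_mono (hball.trans (inter_subset_left.trans hVU)))
end

section
/- Let d ≥ 2, α ∈ (0, d−1), δ > 0, and m ≥ ω_d δ^d. There exists Q_0 = Q_0(α,d) > 0 such that if E ⊆ ℝ^d has |E| = m, satisfies the δ-ball condition, has F_{α,Q}(E) ≤ F_{α,Q}(B_m) where B_m is the ball of volume m, and Q/m^{(d-1+α)/(2d)} ≤ Q_0 δ^d/m, then E is connected. (Key steps: the energy comparison gives the isoperimetric deficit bound P(E) − P(B_m) ≤ Q² I_α(B_m); the quantitative isoperimetric inequality gives |E Δ B_m|² ≤ C(d) m (P(E) − P(B_m)) up to translation; and each connected component of a set in K_δ has volume at least ω_d δ^d, so for Q small E has only one component.) -/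
open MeasureTheory Metric Filter Set ENNReal

/-- The δ-ball condition: internal and external tangent balls of radius δ at every
boundary point. -/
def BallCond {d : ℕ} (δ : ℝ) (E : Set (EuclideanSpace ℝ (Fin d))) : Prop :=
  ∀ x ∈ frontier E,
    (∃ y, x ∈ Metric.sphere y δ ∧ Metric.closedBall y δ ⊆ E) ∧
    (∃ y, x ∈ Metric.sphere y δ ∧ Metric.ball y δ ⊆ Eᶜ)

/-- The energy `F_{α,Q}(E) = P(E) + Q² I_α(E)`, with the perimeter realized (for sets
with `C^{1,1}` boundary) as the `(d-1)`-dimensional Hausdorff measure of the boundary. -/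
noncomputable def Fen {d : ℕ} (α Q : ℝ) (E : Set (EuclideanSpace ℝ (Fin d))) : ℝ≥0∞ :=
  μH[(d : ℝ) - 1] (frontier E) + ENNReal.ofReal (Q ^ 2) * rieszEnergy α E

open scoped Pointwise in
/-- The one-dimensional Brunn–Minkowski inequality. -/
lemma volume_add_le_of_mem_add {a b : ℝ} (ha : 0 < a) (hb : 0 < b) {A B C : Set ℝ}
    (hA : MeasurableSet A) (hB : MeasurableSet B) (hA0 : A.Nonempty) (hB0 : B.Nonempty)
    (hC : ∀ x ∈ A, ∀ y ∈ B, a * x + b * y ∈ C) :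
    ENNReal.ofReal a * volume A + ENNReal.ofReal b * volume B ≤ volume C := by
  have compact_case : ∀ K ⊆ A, IsCompact K → ∀ L ⊆ B, IsCompact L → K.Nonempty → L.Nonempty →
      ENNReal.ofReal a * volume K + ENNReal.ofReal b * volume L ≤ volume C := by
    intro K hKA hK L hLB hL hK0 hL0
    obtain ⟨u, huK, hu⟩ := hK.exists_isGreatest hK0
    obtain ⟨v, hvL, hv⟩ := hL.exists_isLeast hL0
    have hK' : volume ((fun x => a * x + b * v) '' K) = ENNReal.ofReal a * volume K := by
      have : (fun x => a * x + b * v) '' K = (fun x => x + b * v) '' (a • K) := by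
        rw [← image_smul, image_image]; rfl
      rw [this, image_add_right, measure_preimage_add_right, Measure.addHaar_smul]
      simp [abs_of_pos ha]
    have hL' : volume ((fun y => a * u + b * y) '' L) = ENNReal.ofReal b * volume L := by
      have : (fun y => a * u + b * y) '' L = (fun x => a * u + x) '' (b • L) := by
        rw [← image_smul, image_image]; rfl
      rw [this, image_add_left, measure_preimage_add, Measure.addHaar_smul]
      simp [abs_of_pos hb]
    rw [← hK', ← hL', ← measure_union₀]
    · apply measure_mono
      rintro _ (⟨x, hx, rfl⟩ | ⟨y, hy, rfl⟩)
      · exact hC _ (hKA hx) _ (hLB hvL)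
      · exact hC _ (hKA huK) _ (hLB hy)
    · exact (hL.image (by fun_prop)).measurableSet.nullMeasurableSet
    · refine measure_mono_null (t := {a * u + b * v}) ?_ (by simp)
      rintro _ ⟨⟨x, hx, rfl⟩, y, hy, hxy⟩
      simp only [mem_singleton_iff] at hxy ⊢
      have := hu hx
      have := hv hy
      nlinarith
  obtain ⟨x₀, hx₀⟩ := hA0
  obtain ⟨y₀, hy₀⟩ := hB0
  rw [hA.measure_eq_iSup_isCompact, hB.measure_eq_iSup_isCompact]
  simp only [iSup_and', ENNReal.mul_iSup]
  refine ENNReal.biSup_add_biSup_le' ⟨∅, by simp⟩ ⟨∅, by simp⟩ ?_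
  rintro K ⟨hKA, hK⟩ L ⟨hLB, hL⟩
  refine le_trans ?_ (compact_case (insert x₀ K) (insert_subset hx₀ hKA) (hK.insert _)
    (insert y₀ L) (insert_subset hy₀ hLB) (hL.insert _) ⟨x₀, by simp⟩ ⟨y₀, by simp⟩)
  gcongr <;> exact subset_insert _ _

/-- The layer cake formula for functions with values in `ℝ≥0∞`. -/
lemma lintegral_eq_lintegral_meas_ofReal_lt {f : ℝ → ℝ≥0∞} (hf : Measurable f) :
    ∫⁻ x, f x = ∫⁻ t in Ioi (0 : ℝ), volume {x | ENNReal.ofReal t < f x} := by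
  have hm : MeasurableSet {p : ℝ × ℝ | ENNReal.ofReal p.2 < f p.1} :=
    measurableSet_lt (by fun_prop) (by fun_prop)
  have h1 : ∀ x, f x = ∫⁻ t in Ioi (0 : ℝ),
      {p : ℝ × ℝ | ENNReal.ofReal p.2 < f p.1}.indicator 1 (x, t) := by
    intro x
    have : (fun t : ℝ => {p : ℝ × ℝ | ENNReal.ofReal p.2 < f p.1}.indicator (1 : ℝ × ℝ → ℝ≥0∞) (x, t))
        = {t : ℝ | ENNReal.ofReal t < f x}.indicator 1 := by
      ext t; simp [indicator]
    rw [this, lintegral_indicator_one (measurableSet_lt (by fun_prop) (by fun_prop)),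
      Measure.restrict_apply (measurableSet_lt (by fun_prop) (by fun_prop))]
    by_cases h : f x = ∞
    · simp [h]
    · have : {t : ℝ | ENNReal.ofReal t < f x} ∩ Ioi 0 = Ioo 0 (f x).toReal := by
        ext t
        simp only [mem_inter_iff, mem_ofPred_eq, mem_Ioi, mem_Ioo]
        constructor
        · rintro ⟨h1, h2⟩; exact ⟨h2, (ENNReal.ofReal_lt_iff_lt_toReal h2.le h).1 h1⟩
        · rintro ⟨h1, h2⟩; exact ⟨(ENNReal.ofReal_lt_iff_lt_toReal h1.le h).2 h2, h1⟩
      rw [this]; simp [h]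
  calc ∫⁻ x, f x = ∫⁻ x, ∫⁻ t in Ioi (0 : ℝ),
      {p : ℝ × ℝ | ENNReal.ofReal p.2 < f p.1}.indicator 1 (x, t) := lintegral_congr h1
    _ = ∫⁻ t in Ioi (0 : ℝ), ∫⁻ x,
      {p : ℝ × ℝ | ENNReal.ofReal p.2 < f p.1}.indicator 1 (x, t) :=
        lintegral_lintegral_swap (by
          exact (measurable_one.indicator hm).aemeasurable)
    _ = _ := by
      refine lintegral_congr fun t => ?_
      have : (fun x : ℝ => {p : ℝ × ℝ | ENNReal.ofReal p.2 < f p.1}.indicator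
          (1 : ℝ × ℝ → ℝ≥0∞) (x, t)) = {x : ℝ | ENNReal.ofReal t < f x}.indicator 1 := by
        ext t; simp [indicator]
      rw [this, lintegral_indicator_one (measurableSet_lt (by fun_prop) (by fun_prop))]

lemma ENNReal.rpow_mul_rpow_le_add {a b : ℝ} (ha : 0 < a) (hb : 0 < b) (hab : a + b = 1)
    (x y : ℝ≥0∞) : x ^ a * y ^ b ≤ ENNReal.ofReal a * x + ENNReal.ofReal b * y := by
  rcases eq_or_ne x ∞ with rfl | hx
  · simp [ENNReal.mul_top, ha]
  rcases eq_or_ne y ∞ with rfl | hy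
  · simp [ENNReal.mul_top, hb]
  lift x to NNReal using hx
  lift y to NNReal using hy
  have := NNReal.geom_mean_le_arith_mean2_weighted a.toNNReal b.toNNReal x y
    (by rw [← Real.toNNReal_add ha.le hb.le, hab]; simp)
  rw [Real.coe_toNNReal _ ha.le, Real.coe_toNNReal _ hb.le] at this
  rw [← ENNReal.coe_rpow_of_nonneg _ ha.le, ← ENNReal.coe_rpow_of_nonneg _ hb.le]
  simp only [ENNReal.ofReal]
  exact_mod_cast this

/-- The Prékopa–Leindler inequality with weights `a`, `b`, as a property of a measure. -/
def PrekopaLeindler {V : Type*} [AddCommGroup V] [Module ℝ V] [MeasurableSpace V]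
    (a b : ℝ) (μ : Measure V) : Prop :=
  ∀ f g h : V → ℝ≥0∞, Measurable f → Measurable g → Measurable h →
    (∀ x y, f x ^ a * g y ^ b ≤ h (a • x + b • y)) →
    (∫⁻ x, f x ∂μ) ^ a * (∫⁻ x, g x ∂μ) ^ b ≤ ∫⁻ x, h x ∂μ

lemma lintegral_add_le_of_normalized {a b : ℝ} (ha : 0 < a) (hb : 0 < b) (hab : a + b = 1)
    {f g h : ℝ → ℝ≥0∞} (hf : Measurable f) (hg : Measurable g) (hh : Measurable h)
    (hf1 : ∀ x, f x ≤ 1) (hg1 : ∀ x, g x ≤ 1) (hfs : ∀ s < 1, ∃ x, s < f x)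
    (hgs : ∀ s < 1, ∃ x, s < g x) (H : ∀ x y, f x ^ a * g y ^ b ≤ h (a * x + b * y)) :
    ENNReal.ofReal a * (∫⁻ x, f x) + ENNReal.ofReal b * (∫⁻ x, g x) ≤ ∫⁻ x, h x := by
  rw [lintegral_eq_lintegral_meas_ofReal_lt hf, lintegral_eq_lintegral_meas_ofReal_lt hg,
    lintegral_eq_lintegral_meas_ofReal_lt hh]
  have anti : ∀ u : ℝ → ℝ≥0∞, Measurable fun t : ℝ => volume {x | ENNReal.ofReal t < u x} := by
    intro u
    refine Antitone.measurable fun s t hst => measure_mono fun x hx => ?_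
    exact (ENNReal.ofReal_le_ofReal hst).trans_lt hx
  rw [← lintegral_const_mul _ (anti f), ← lintegral_const_mul _ (anti g),
    ← lintegral_add_left ((anti f).const_mul _)]
  refine lintegral_mono fun t => ?_
  by_cases ht : ENNReal.ofReal t < 1
  · refine volume_add_le_of_mem_add ha hb (measurableSet_lt measurable_const hf)
      (measurableSet_lt measurable_const hg) (hfs _ ht) (hgs _ ht) fun x hx y hy => ?_
    refine lt_of_lt_of_le ?_ (H x y)
    rw [mem_ofPred_eq] at hx hy
    calc ENNReal.ofReal t = ENNReal.ofReal t ^ a * ENNReal.ofReal t ^ b := by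
          rw [← ENNReal.rpow_add_of_nonneg _ _ ha.le hb.le, hab, ENNReal.rpow_one]
      _ < f x ^ a * g y ^ b :=
        ENNReal.mul_lt_mul (ENNReal.rpow_lt_rpow hx ha) (ENNReal.rpow_lt_rpow hy hb)
  · have h1 : {x | ENNReal.ofReal t < f x} = ∅ := by
      ext x; simpa using (hf1 x).trans (not_lt.1 ht)
    have h2 : {x | ENNReal.ofReal t < g x} = ∅ := by
      ext x; simpa using (hg1 x).trans (not_lt.1 ht)
    simp [h1, h2]

lemma prekopaLeindler_bounded {a b : ℝ} (ha : 0 < a) (hb : 0 < b) (hab : a + b = 1)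
    {f g h : ℝ → ℝ≥0∞} (hf : Measurable f) (hg : Measurable g) (hh : Measurable h)
    {c : ℝ≥0∞} (hc : c ≠ ∞) (hfc : ∀ x, f x ≤ c) (hgc : ∀ x, g x ≤ c)
    (H : ∀ x y, f x ^ a * g y ^ b ≤ h (a * x + b * y)) :
    (∫⁻ x, f x) ^ a * (∫⁻ x, g x) ^ b ≤ ∫⁻ x, h x := by
  set M := ⨆ x, f x with hM
  set N := ⨆ x, g x with hN
  have hM1 : M ≠ ∞ := ((iSup_le hfc).trans_lt hc.lt_top).ne
  have hN1 : N ≠ ∞ := ((iSup_le hgc).trans_lt hc.lt_top).ne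
  rcases eq_or_ne M 0 with hM0 | hM0
  · have : ∀ x, f x = 0 := by simpa [hM] using hM0
    simp [this, ha]
  rcases eq_or_ne N 0 with hN0 | hN0
  · have : ∀ x, g x = 0 := by simpa [hN] using hN0
    simp [this, hb]
  have nsup : ∀ (u : ℝ → ℝ≥0∞) (K : ℝ≥0∞), K = ⨆ x, u x → K ≠ 0 → K ≠ ∞ →
      (∀ x, K⁻¹ * u x ≤ 1) ∧ ∀ s < 1, ∃ x, s < K⁻¹ * u x := by
    rintro u K hK hK0 hK1
    refine ⟨fun x => ?_, fun s hs => ?_⟩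
    · rw [← ENNReal.inv_mul_cancel hK0 hK1]
      gcongr
      rw [hK]; exact le_iSup u x
    · have : s * K < ⨆ x, u x := by
        rw [← hK]
        simpa using ENNReal.mul_lt_mul_left hK0 hK1 hs
      obtain ⟨x, hx⟩ := lt_iSup_iff.1 this
      refine ⟨x, ?_⟩
      rw [mul_comm, ← div_eq_mul_inv]
      exact (ENNReal.lt_div_iff_mul_lt (.inl hK0) (.inl hK1)).2 hx
  obtain ⟨hf1, hfs⟩ := nsup f M hM hM0 hM1
  obtain ⟨hg1, hgs⟩ := nsup g N hN hN0 hN1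
  set P := M ^ a * N ^ b with hP
  have hP0 : P ≠ 0 := mul_ne_zero (by simp [hM0, hM1]) (by simp [hN0, hN1])
  have hP1 : P ≠ ∞ := ENNReal.mul_ne_top (by simp [ha.le, hM1]) (by simp [hb.le, hN1])
  have hPinv : P⁻¹ = (M⁻¹) ^ a * (N⁻¹) ^ b := by
    rw [hP, ENNReal.mul_inv (.inl (by simp [hM0, hM1])) (.inl (by simp [ha.le, hM1])),
      ENNReal.inv_rpow, ENNReal.inv_rpow]
  have key := lintegral_add_le_of_normalized ha hb hab (hf.const_mul M⁻¹) (hg.const_mul N⁻¹)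
    (hh.const_mul P⁻¹) hf1 hg1 hfs hgs (fun x y => by
      rw [ENNReal.mul_rpow_of_nonneg _ _ ha.le, ENNReal.mul_rpow_of_nonneg _ _ hb.le, hPinv]
      calc _ = (M⁻¹) ^ a * (N⁻¹) ^ b * (f x ^ a * g y ^ b) := by ring
        _ ≤ _ := by gcongr; exact H x y)
  have key2 := (ENNReal.rpow_mul_rpow_le_add ha hb hab _ _).trans key
  rw [lintegral_const_mul _ hf, lintegral_const_mul _ hg, lintegral_const_mul _ hh,
    ENNReal.mul_rpow_of_nonneg _ _ ha.le, ENNReal.mul_rpow_of_nonneg _ _ hb.le, hPinv] at key2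
  rw [← ENNReal.mul_le_mul_iff_right (a := P⁻¹) (by simp [hP1]) (by simp [hP0])]
  rw [hPinv]
  refine le_trans (le_of_eq ?_) key2
  ring

lemma prekopaLeindler_real {a b : ℝ} (ha : 0 < a) (hb : 0 < b) (hab : a + b = 1) :
    PrekopaLeindler a b (volume : Measure ℝ) := by
  intro f g h hf hg hh H
  have mono : ∀ u : ℝ → ℝ≥0∞, Monotone fun n : ℕ => fun x => min (u x) n := by
    intro u m n hmn x
    dsimp only
    gcongr
  have sup : ∀ u : ℝ → ℝ≥0∞, ∀ x, ⨆ n : ℕ, min (u x) n = u x := by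
    intro u x
    rw [← inf_iSup_eq, ENNReal.iSup_natCast, inf_top_eq]
  have tend : ∀ u : ℝ → ℝ≥0∞, Measurable u →
      Tendsto (fun n : ℕ => ∫⁻ x, min (u x) n) atTop (nhds (∫⁻ x, u x)) := by
    intro u hu
    refine lintegral_tendsto_of_tendsto_of_monotone (fun n => by fun_prop) ?_ ?_
    · exact .of_forall fun x m n hmn => mono u hmn x
    · refine .of_forall fun x => ?_
      have := tendsto_atTop_iSup (fun m n hmn => mono u hmn x :
        Monotone fun n : ℕ => min (u x) (n : ℝ≥0∞))
      rwa [sup] at this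
  rcases eq_or_ne (∫⁻ x, f x) 0 with h0 | hf0
  · simp [h0, ha]
  rcases eq_or_ne (∫⁻ x, g x) 0 with h0 | hg0
  · simp [h0, hb]
  refine le_of_tendsto (ENNReal.Tendsto.mul ((ENNReal.continuous_rpow_const.tendsto _).comp
    (tend f hf)) (.inl (by simp [hf0, ha.le])) ((ENNReal.continuous_rpow_const.tendsto _).comp
    (tend g hg)) (.inl (by simp [hg0, hb.le]))) (.of_forall fun n => ?_)
  refine prekopaLeindler_bounded ha hb hab (by fun_prop) (by fun_prop) hh (c := n) (by simp)
    (fun x => min_le_right _ _) (fun x => min_le_right _ _) fun x y => ?_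
  refine le_trans ?_ (H x y)
  gcongr <;> exact min_le_left _ _

lemma PrekopaLeindler.prod {V W : Type*} [AddCommGroup V] [Module ℝ V] [MeasurableSpace V]
    [AddCommGroup W] [Module ℝ W] [MeasurableSpace W] {a b : ℝ} {μ : Measure V} {ν : Measure W}
    [SFinite ν] (hμ : PrekopaLeindler a b μ) (hν : PrekopaLeindler a b ν) :
    PrekopaLeindler a b (μ.prod ν) := by
  intro f g h hf hg hh H
  rw [lintegral_prod _ hf.aemeasurable, lintegral_prod _ hg.aemeasurable,
    lintegral_prod _ hh.aemeasurable]
  refine hμ _ _ _ hf.lintegral_prod_right' hg.lintegral_prod_right' hh.lintegral_prod_right'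
    fun x y => ?_
  exact hν _ _ _ (by fun_prop) (by fun_prop) (by fun_prop) fun z w => H (x, z) (y, w)

lemma PrekopaLeindler.of_measurePreserving {V W : Type*} [AddCommGroup V] [Module ℝ V]
    [MeasurableSpace V] [AddCommGroup W] [Module ℝ W] [MeasurableSpace W] {a b : ℝ}
    {μ : Measure V} {ν : Measure W} (hμ : PrekopaLeindler a b μ) {φ : V → W}
    (hφ : MeasurePreserving φ μ ν) (hlin : ∀ x y, φ (a • x + b • y) = a • φ x + b • φ y) :
    PrekopaLeindler a b ν := by
  intro f g h hf hg hh H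
  rw [← hφ.lintegral_comp hf, ← hφ.lintegral_comp hg, ← hφ.lintegral_comp hh]
  exact hμ _ _ _ (hf.comp hφ.measurable) (hg.comp hφ.measurable) (hh.comp hφ.measurable)
    fun x y => by rw [hlin]; exact H _ _

lemma prekopaLeindler_pi {a b : ℝ} (ha : 0 < a) (hb : 0 < b) (hab : a + b = 1) (n : ℕ) :
    PrekopaLeindler a b (volume : Measure (Fin n → ℝ)) := by
  induction n with
  | zero =>
    intro f g h hf hg hh H
    have integral_eq : ∀ u : (Fin 0 → ℝ) → ℝ≥0∞, ∫⁻ x, u x = u 0 := by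
      intro u
      calc ∫⁻ x, u x = ∫⁻ _, u 0 := lintegral_congr fun x => by rw [Subsingleton.elim x 0]
        _ = u 0 := by simp [volume_pi]
    simpa [integral_eq] using H 0 0
  | succ n ih =>
    refine ((prekopaLeindler_real ha hb hab).prod ih).of_measurePreserving
      (volume_preserving_piFinSuccAbove (fun _ => ℝ) 0).symm fun x y => ?_
    ext i
    refine Fin.cases ?_ (fun i => ?_) i <;> simp [MeasurableEquiv.piFinSuccAbove]

/-- The Prékopa–Leindler inequality in Euclidean space. -/
lemma prekopaLeindler_euclideanSpace {a b : ℝ} (ha : 0 < a) (hb : 0 < b) (hab : a + b = 1)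
    (n : ℕ) : PrekopaLeindler a b (volume : Measure (EuclideanSpace ℝ (Fin n))) :=
  (prekopaLeindler_pi ha hb hab n).of_measurePreserving
    (PiLp.volume_preserving_toLp (Fin n)) fun _ _ => rfl

/-- The Brunn–Minkowski inequality for sets of volume one. -/
lemma one_le_volume_of_mem_add {n : ℕ} {a b : ℝ} (ha : 0 < a) (hb : 0 < b) (hab : a + b = 1)
    {A B C : Set (EuclideanSpace ℝ (Fin n))} (hA : MeasurableSet A) (hB : MeasurableSet B)
    (hC : MeasurableSet C) (hA1 : volume A = 1) (hB1 : volume B = 1)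
    (hABC : ∀ x ∈ A, ∀ y ∈ B, a • x + b • y ∈ C) : 1 ≤ volume C := by
  have := prekopaLeindler_euclideanSpace ha hb hab n (A.indicator 1) (B.indicator 1)
    (C.indicator 1) (measurable_one.indicator hA) (measurable_one.indicator hB)
    (measurable_one.indicator hC) (fun x y => by
      by_cases hx : x ∈ A
      · by_cases hy : y ∈ B
        · simp [hx, hy, hABC x hx y hy]
        · simp [hy, hb]
      · simp [hx, ha])
  simpa [lintegral_indicator_one, hA, hB, hC, hA1, hB1] using this

open scoped Pointwise in
/-- The Brunn–Minkowski inequality for a set and a ball. -/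
lemma add_pow_le_volume_thickening {n : ℕ} {A : Set (EuclideanSpace ℝ (Fin n))}
    (hA : MeasurableSet A) {u w ε : ℝ} (hu : 0 < u) (hw : 0 < w) (hε : 0 < ε)
    (hAu : volume A = ENNReal.ofReal (u ^ n))
    (hBw : volume (ball (0 : EuclideanSpace ℝ (Fin n)) 1) = ENNReal.ofReal (w ^ n)) :
    ENNReal.ofReal ((u + ε * w) ^ n) ≤ volume (thickening ε A) := by
  set s := u + ε * w with hs
  have hs0 : 0 < s := by positivity
  have scale : ∀ (r : ℝ), 0 < r → ∀ S : Set (EuclideanSpace ℝ (Fin n)),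
      volume S = ENNReal.ofReal (r ^ n) → volume (r⁻¹ • S) = 1 := by
    intro r hr S hS
    rw [Measure.addHaar_smul, hS, finrank_euclideanSpace_fin, abs_of_pos (by positivity),
      ← ENNReal.ofReal_mul (by positivity), ← mul_pow, inv_mul_cancel₀ hr.ne']
    simp
  have hball : volume (ball (0 : EuclideanSpace ℝ (Fin n)) ε) = ENNReal.ofReal ((ε * w) ^ n) := by
    rw [Measure.addHaar_ball_of_pos _ _ hε, hBw, finrank_euclideanSpace_fin,
      ← ENNReal.ofReal_mul (by positivity), mul_pow]
  have key := one_le_volume_of_mem_add (n := n) (a := u / s) (b := ε * w / s)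
    (by positivity) (by positivity) (by field_simp; exact hs.symm)
    (hA.const_smul_of_ne_zero (inv_ne_zero hu.ne')) (measurableSet_ball.const_smul_of_ne_zero
      (inv_ne_zero (show ε * w ≠ 0 by positivity)))
    ((isOpen_thickening (δ := ε) (E := A)).measurableSet.const_smul_of_ne_zero
      (inv_ne_zero hs0.ne'))
    (scale u hu A hAu) (scale (ε * w) (by positivity) _ hball) (by
      rintro _ ⟨x, hx, rfl⟩ _ ⟨y, hy, rfl⟩
      refine ⟨x + y, mem_thickening_iff.2 ⟨x, hx, ?_⟩, ?_⟩
      · simpa [dist_eq_norm] using hy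
      · simp only [smul_smul, smul_add]
        congr 2 <;> field_simp)
  rw [Measure.addHaar_smul, finrank_euclideanSpace_fin, abs_of_pos (by positivity)] at key
  calc ENNReal.ofReal (s ^ n) = ENNReal.ofReal (s ^ n) * 1 := by simp
    _ ≤ ENNReal.ofReal (s ^ n) * (ENNReal.ofReal (s⁻¹ ^ n) * volume (thickening ε A)) := by
      gcongr
    _ = volume (thickening ε A) := by
      rw [← mul_assoc, ← ENNReal.ofReal_mul (by positivity), ← mul_pow, mul_inv_cancel₀ hs0.ne']
      simp

lemma lintegral_ball_enorm_rpow_lt_top {k : ℕ} {α : ℝ} (hα : α < k + 1) (r : ℝ) :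
    ∫⁻ x in ball (0 : EuclideanSpace ℝ (Fin (k + 1))) r, ‖x‖ₑ ^ (-α) < ∞ := by
  have hint : IntegrableOn (fun x : EuclideanSpace ℝ (Fin (k + 1)) => ‖x‖ ^ (-α)) (ball 0 r) := by
    rw [integrableOn_fun_norm_addHaar volume (f := fun t : ℝ => t ^ (-α))]
    rcases le_or_gt r 0 with hr | hr
    · simp [Ioo_eq_empty_of_le hr]
    · have h1 : IntegrableOn (fun y : ℝ => y ^ ((k : ℝ) - α)) (Ioo 0 r) :=
        (intervalIntegral.integrableOn_Ioo_rpow_iff hr).2 (by linarith)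
      refine h1.congr_fun (fun y hy => ?_) measurableSet_Ioo
      simp only [finrank_euclideanSpace_fin, Nat.add_sub_cancel, smul_eq_mul]
      rw [sub_eq_add_neg, Real.rpow_add hy.1, Real.rpow_natCast]
  refine lt_of_eq_of_lt (lintegral_congr_ae ?_) hint.2
  refine (ae_restrict_of_ae (Measure.ae_ne volume 0)).mono fun x hx => ?_
  dsimp only
  have hx' : 0 < ‖x‖ := norm_pos_iff.2 hx
  rw [Real.enorm_of_nonneg (by positivity), ← ENNReal.ofReal_rpow_of_pos hx', ofReal_norm]

lemma rieszEnergy_closedBall_le {k : ℕ} {α : ℝ} (hα : α < k + 1) :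
    ∃ C : ℝ≥0∞, C ≠ ∞ ∧ ∀ r : ℝ, 0 < r →
      rieszEnergy α (closedBall (0 : EuclideanSpace ℝ (Fin (k + 1))) r) ≤
        ENNReal.ofReal (r ^ (-α)) * C := by
  set E := EuclideanSpace ℝ (Fin (k + 1))
  set B : Set E := closedBall 0 1
  set c := volume B with hc
  have hc0 : c ≠ 0 := (measure_closedBall_pos volume (0 : E) one_pos).ne'
  have hc1 : c ≠ ∞ := measure_closedBall_lt_top.ne
  set μ : Measure E := c⁻¹ • volume.restrict B with hμ
  have hμp : IsProbabilityMeasure μ := ⟨by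
    simp [hμ, ← hc, ENNReal.inv_mul_cancel hc0 hc1]⟩
  refine ⟨rieszEnergyOf α μ, ?_, fun r hr => ?_⟩
  · have inner_le : ∀ x ∈ B, ∫⁻ y in B, (edist x y) ^ (-α) ≤
        ∫⁻ z in ball (0 : E) 3, ‖z‖ₑ ^ (-α) := by
      intro x hx
      rw [← lintegral_indicator isClosed_closedBall.measurableSet,
        ← lintegral_indicator measurableSet_ball,
        ← lintegral_sub_left_eq_self ((ball (0 : E) 3).indicator fun z => ‖z‖ₑ ^ (-α)) x]
      refine lintegral_mono fun y => ?_
      by_cases hy : y ∈ B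
      · have : x - y ∈ ball (0 : E) 3 := by
          simp only [B, mem_closedBall, mem_ball, dist_zero_right] at hx hy ⊢
          linarith [norm_sub_le x y]
        rw [indicator_of_mem hy, indicator_of_mem this, edist_eq_enorm_sub]
      · rw [indicator_of_notMem hy]
        exact zero_le
    simp only [rieszEnergyOf, hμ, lintegral_smul_measure, smul_eq_mul]
    rw [lintegral_const_mul' _ _ (by simp [hc0])]
    refine ENNReal.mul_ne_top (by simp [hc0]) (ENNReal.mul_ne_top (by simp [hc0]) ?_)
    refine ((setLIntegral_mono' isClosed_closedBall.measurableSet inner_le).trans_lt ?_).ne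
    rw [setLIntegral_const]
    exact ENNReal.mul_lt_top (lintegral_ball_enorm_rpow_lt_top hα 3) hc1.lt_top
  · have hmeas : Measurable fun x : E => r • x := by fun_prop
    have hprob : IsProbabilityMeasure (μ.map fun x => r • x) :=
      Measure.isProbabilityMeasure_map hmeas.aemeasurable
    have hB : (fun x : E => r • x) ⁻¹' closedBall 0 r = B := by
      ext x
      simp only [B, mem_preimage, mem_closedBall, dist_zero_right, norm_smul, Real.norm_eq_abs,
        abs_of_pos hr]
      exact mul_le_iff_le_one_right hr
    have h1 : μ.map (fun x => r • x) (closedBall 0 r) = 1 := by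
      rw [Measure.map_apply hmeas isClosed_closedBall.measurableSet, hB]
      simp [hμ, ← hc, ENNReal.inv_mul_cancel hc0 hc1]
    refine (iInf₂_le _ ⟨hprob, h1⟩).trans (le_of_eq ?_)
    simp only [rieszEnergyOf]
    rw [lintegral_map (Measurable.lintegral_prod_right' (f := fun p : E × E =>
      (edist p.1 p.2) ^ (-α)) (by fun_prop)) hmeas]
    have : ∀ x : E, ∫⁻ y, (edist (r • x) y) ^ (-α) ∂(μ.map fun x => r • x) =
        ENNReal.ofReal (r ^ (-α)) * ∫⁻ y, (edist x y) ^ (-α) ∂μ := by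
      intro x
      rw [lintegral_map (by fun_prop) hmeas, ← lintegral_const_mul _ (by fun_prop)]
      refine lintegral_congr fun y => ?_
      rw [edist_smul₀, ENNReal.smul_def, smul_eq_mul,
        ENNReal.mul_rpow_of_ne_top (by simp) (edist_ne_top _ _), ← ENNReal.ofReal_rpow_of_pos hr,
        ← Real.enorm_of_nonneg hr.le]
      rfl
    simp_rw [this]
    rw [lintegral_const_mul' _ _ (by simp)]

/-- The region swept out by moving each point `x ∈ A` along `n x` for times in `(0, ε]`. -/
def tube {E : Type*} [AddCommGroup E] [Module ℝ E] (n : E → E) (A : Set E) (ε : ℝ) : Set E :=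
  (fun z : E × ℝ => z.1 + z.2 • n z.1) '' (A ×ˢ Ioc 0 ε)

/-- Tubes over subsets of a hyperplane have volume proportional to their height and to the
Hausdorff measure of their base. -/
lemma exists_volume_tube_hyperplane (k : ℕ) : ∃ κ : ℝ≥0∞, κ ≠ ∞ ∧
    ∀ e : EuclideanSpace ℝ (Fin (k + 1)), ‖e‖ = 1 →
    ∀ S : Set (EuclideanSpace ℝ (Fin (k + 1))), (∀ p ∈ S, inner ℝ p e = 0) → ∀ ε : ℝ,
      volume (tube (fun _ => e) S ε) = κ * μH[(k : ℝ)] S * ENNReal.ofReal ε := by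
  set E := EuclideanSpace ℝ (Fin (k + 1))
  set G := EuclideanSpace ℝ (Fin k)
  let ψ : (G × ℝ) ≃L[ℝ] E := (((WithLp.linearEquiv 2 ℝ (Fin k → ℝ)).prodCongr
    (LinearEquiv.refl ℝ ℝ)) ≪≫ₗ LinearEquiv.prodComm ℝ _ _ ≪≫ₗ
    Fin.consLinearEquiv ℝ (fun _ => ℝ) ≪≫ₗ
    (WithLp.linearEquiv 2 ℝ (Fin (k + 1) → ℝ)).symm).toContinuousLinearEquiv
  have ψ_zero : ∀ p t, ψ (p, t) 0 = t := fun p t => rfl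
  have ψ_succ : ∀ p t i, ψ (p, t) (Fin.succ i) = p i := fun p t i => rfl
  have hG : (μH[(k : ℝ)] : Measure G).IsAddHaarMeasure := by
    have := isAddHaarMeasure_hausdorffMeasure (E := G)
    rwa [finrank_euclideanSpace_fin] at this
  set ν : Measure E := ((μH[(k : ℝ)] : Measure G).prod volume).map ψ
  have hν : ν.IsAddHaarMeasure := ψ.isAddHaarMeasure_map _
  refine ⟨(Measure.addHaarScalarFactor volume ν : NNReal), ENNReal.coe_ne_top, fun e he S hS ε => ?_⟩
  obtain ⟨b, hb⟩ := Orthonormal.exists_orthonormalBasis_extension_of_card_eq (𝕜 := ℝ) (E := E)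
    (ι := Fin (k + 1)) (by simp [E]) (v := fun _ => e) (s := {0}) (by
      rw [orthonormal_iff_ite]
      rintro ⟨i, hi⟩ ⟨j, hj⟩
      obtain rfl : i = 0 := hi
      obtain rfl : j = 0 := hj
      simp [he])
  have hb0 : b 0 = e := hb 0 rfl
  set Ψ := b.repr with hΨ
  have hΨe : ∀ p, Ψ p 0 = inner ℝ p e := fun p => by
    rw [hΨ, b.repr_apply_apply, hb0, real_inner_comm]
  have hι : Isometry fun p : G => Ψ.symm (ψ (p, 0)) := by
    refine Ψ.symm.isometry.comp (Isometry.of_dist_eq fun p q => ?_)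
    rw [EuclideanSpace.dist_eq, EuclideanSpace.dist_eq, Fin.sum_univ_succ]
    simp [ψ_zero, ψ_succ]
  have hadd : ∀ p t, Ψ.symm (ψ (p, 0)) + t • e = Ψ.symm (ψ (p, t)) := fun p t => by
    have he' : e = Ψ.symm (ψ (0, 1)) := by
      rw [← hb0, LinearIsometryEquiv.eq_symm_apply, hΨ, b.repr_self]
      ext i
      refine Fin.cases ?_ (fun i => ?_) i
      · simp [ψ_zero]
      · simp [ψ_succ]
    rw [he', ← map_smul, ← map_smul, ← map_add, ← map_add]
    simp
  set S' : Set G := (fun p : G => Ψ.symm (ψ (p, 0))) ⁻¹' S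
  have hSS' : (fun p : G => Ψ.symm (ψ (p, 0))) '' S' = S := by
    refine image_preimage_eq_of_subset fun p hp => ⟨(ψ.symm (Ψ p)).1, ?_⟩
    have h0 : (ψ.symm (Ψ p)).2 = 0 := by
      rw [← ψ_zero (ψ.symm (Ψ p)).1 (ψ.symm (Ψ p)).2, Prod.mk.eta, ψ.apply_symm_apply, hΨe, hS p hp]
    dsimp only
    rw [← h0, Prod.mk.eta, ψ.apply_symm_apply, Ψ.symm_apply_apply]
  have htube : tube (fun _ => e) S ε = Ψ.symm '' (ψ '' (S' ×ˢ Ioc 0 ε)) := by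
    rw [tube, ← hSS', image_image]
    ext y
    constructor
    · rintro ⟨⟨_, t⟩, ⟨⟨p, hp, rfl⟩, ht⟩, rfl⟩
      exact ⟨(p, t), ⟨hp, ht⟩, (hadd p t).symm⟩
    · rintro ⟨⟨p, t⟩, ⟨hp, ht⟩, rfl⟩
      exact ⟨(_, t), ⟨⟨p, hp, rfl⟩, ht⟩, hadd p t⟩
  have hvol : (volume : Measure E) = (volume : Measure E).addHaarScalarFactor ν • ν :=
    Measure.isAddLeftInvariant_eq_smul _ _
  have hν_image : ν (ψ '' (S' ×ˢ Ioc 0 ε)) = μH[(k : ℝ)] S' * ENNReal.ofReal ε := by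
    calc ν (ψ '' (S' ×ˢ Ioc 0 ε))
        = ((μH[(k : ℝ)] : Measure G).prod volume) (ψ ⁻¹' (ψ '' (S' ×ˢ Ioc 0 ε))) :=
          ψ.toHomeomorph.toMeasurableEquiv.map_apply _
      _ = _ := by
        rw [preimage_image_eq _ ψ.injective, Measure.prod_prod, Real.volume_Ioc, sub_zero]
  have hΨ_image : Ψ.symm '' (ψ '' (S' ×ˢ Ioc 0 ε)) = Ψ ⁻¹' (ψ '' (S' ×ˢ Ioc 0 ε)) :=
    Ψ.toEquiv.symm.image_eq_preimage_symm _
  rw [htube, hΨ_image, ← hSS', hι.hausdorffMeasure_image (.inl (by positivity))]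
  calc volume (Ψ ⁻¹' (ψ '' (S' ×ˢ Ioc 0 ε))) = volume (ψ '' (S' ×ˢ Ioc 0 ε)) :=
        MeasurePreserving.measure_preimage_equiv (f := Ψ.toMeasurableEquiv)
          Ψ.measurePreserving _
    _ = _ := by
      conv_lhs => rw [hvol]
      rw [Measure.smul_apply, hν_image, ENNReal.smul_def, smul_eq_mul, mul_assoc]

/-- A field of unit vectors along `S` which is `L`-Lipschitz and normal to `S` up to second
order. -/
structure IsLipschitzNormal {E : Type*} [NormedAddCommGroup E] [InnerProductSpace ℝ E]
    (L : ℝ) (S : Set E) (n : E → E) : Prop where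
  norm_eq_one : ∀ x ∈ S, ‖n x‖ = 1
  norm_sub_le : ∀ x ∈ S, ∀ y ∈ S, ‖n x - n y‖ ≤ L * ‖x - y‖
  abs_inner_le : ∀ x ∈ S, ∀ y ∈ S, |inner ℝ (x - y) (n y)| ≤ L * ‖x - y‖ ^ 2

section Geometry

variable {E : Type*} [NormedAddCommGroup E] [InnerProductSpace ℝ E]

lemma norm_sub_inner_smul_add_sq {e : E} (he : ‖e‖ = 1) (w : E) (s : ℝ) :
    ‖w - inner ℝ w e • e + s • e‖ ^ 2 = ‖w - inner ℝ w e • e‖ ^ 2 + s ^ 2 := by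
  have h0 : inner ℝ (w - inner ℝ w e • e) (s • e) = 0 := by
    rw [inner_smul_right, inner_sub_left, real_inner_smul_left, real_inner_self_eq_norm_sq, he]
    ring
  rw [norm_add_sq_real, h0, norm_smul, he]
  simp

/-- Near a base point, moving along a Lipschitz normal field is close to moving along the fixed
normal at the base point. -/
lemma norm_tube_sub_flat_le {e v v' w : E} {t t' θ L : ℝ} (he : ‖e‖ = 1)
    (hvv : ‖v - v'‖ ≤ L * ‖w‖) (hve : ‖v' - e‖ ≤ θ) (hwe : |inner ℝ w e| ≤ 2 * θ * ‖w‖)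
    (ht : 0 ≤ t) (htL : L * t ≤ θ) (hθ : θ ≤ 1 / 4) :
    ‖(w + t • v - t' • v') - (w - inner ℝ w e • e + (t - t') • e)‖ ≤
      7 * θ * ‖w - inner ℝ w e • e + (t - t') • e‖ := by
  set q := w - inner ℝ w e • e
  set u := q + (t - t') • e
  have hθ0 : 0 ≤ θ := (norm_nonneg _).trans hve
  have hu : ‖u‖ ^ 2 = ‖q‖ ^ 2 + (t - t') ^ 2 := norm_sub_inner_smul_add_sq he w _
  have hqu : ‖q‖ ≤ ‖u‖ := abs_le_of_sq_le_sq' (by nlinarith [sq_nonneg (t - t')]) (norm_nonneg _) |>.2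
  have htu : |t - t'| ≤ ‖u‖ := abs_le_of_sq_le_sq (by nlinarith [sq_nonneg ‖q‖]) (norm_nonneg _)
  have hwq : ‖w‖ ≤ 2 * ‖q‖ := by
    have h1 : ‖w‖ ≤ ‖q‖ + |inner ℝ w e| := by
      calc ‖w‖ = ‖q + inner ℝ w e • e‖ := by simp [q]
        _ ≤ _ := (norm_add_le _ _).trans (by rw [norm_smul, he, Real.norm_eq_abs, mul_one])
    nlinarith [norm_nonneg w]
  have herr : (w + t • v - t' • v') - u =
      inner ℝ w e • e + t • (v - v') + (t - t') • (v' - e) := by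
    simp only [u, q]; module
  rw [herr]
  have h2 : ‖inner ℝ w e • e‖ ≤ 2 * θ * ‖w‖ := by
    rwa [norm_smul, he, mul_one]
  have h3 : ‖t • (v - v')‖ ≤ θ * ‖w‖ := by
    rw [norm_smul, Real.norm_eq_abs, abs_of_nonneg ht]
    calc t * ‖v - v'‖ ≤ t * (L * ‖w‖) := by gcongr
      _ = L * t * ‖w‖ := by ring
      _ ≤ _ := by gcongr
  have h4 : ‖(t - t') • (v' - e)‖ ≤ ‖u‖ * θ := by
    rw [norm_smul, Real.norm_eq_abs]
    gcongr
  refine (norm_add₃_le).trans ?_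
  nlinarith [norm_nonneg w, norm_nonneg u, mul_le_mul_of_nonneg_left hwq hθ0,
    mul_le_mul_of_nonneg_left hqu hθ0]

end Geometry

section HausdorffComparison

lemma hausdorffMeasure_image_le_of_dist_le {ι X Y : Type*} [MetricSpace X] [MeasurableSpace X]
    [BorelSpace X] [MetricSpace Y] [MeasurableSpace Y] [BorelSpace Y] {F : ι → X} {G : ι → Y}
    {Z : Set ι} {K : NNReal} (h : ∀ z ∈ Z, ∀ z' ∈ Z, dist (G z) (G z') ≤ K * dist (F z) (F z'))
    {s : ℝ} (hs : 0 ≤ s) : μH[s] (G '' Z) ≤ (K : ℝ≥0∞) ^ s * μH[s] (F '' Z) := by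
  rcases isEmpty_or_nonempty ι with hι | hι
  · simp [Set.eq_empty_of_isEmpty Z]
  set g : X → Y := fun x => G (Function.invFunOn F Z x)
  have hmem : ∀ z ∈ Z, Function.invFunOn F Z (F z) ∈ Z ∧ F (Function.invFunOn F Z (F z)) = F z :=
    fun z hz => Function.invFunOn_pos ⟨z, hz, rfl⟩
  have hg : ∀ z ∈ Z, g (F z) = G z := fun z hz => by
    have := h _ (hmem z hz).1 z hz
    rw [(hmem z hz).2, dist_self, mul_zero] at this
    exact dist_le_zero.1 this
  have hlip : LipschitzOnWith K g (F '' Z) := by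
    refine LipschitzOnWith.of_dist_le_mul ?_
    rintro _ ⟨z, hz, rfl⟩ _ ⟨z', hz', rfl⟩
    rw [hg z hz, hg z' hz']
    exact h z hz z' hz'
  have : G '' Z = g '' (F '' Z) := by
    rw [image_image]
    exact image_congr fun z hz => (hg z hz).symm
  rw [this]
  exact hlip.hausdorffMeasure_image_le hs

lemma volume_image_le_of_dist_le {ι : Type*} {d : ℕ} {F G : ι → EuclideanSpace ℝ (Fin d)}
    {Z : Set ι} {K : NNReal} (h : ∀ z ∈ Z, ∀ z' ∈ Z, dist (G z) (G z') ≤ K * dist (F z) (F z')) :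
    volume (G '' Z) ≤ (K : ℝ≥0∞) ^ d * volume (F '' Z) := by
  have hH : (μH[(d : ℝ)] : Measure (EuclideanSpace ℝ (Fin d))).IsAddHaarMeasure := by
    have := isAddHaarMeasure_hausdorffMeasure (E := EuclideanSpace ℝ (Fin d))
    rwa [finrank_euclideanSpace_fin] at this
  rw [Measure.isAddLeftInvariant_eq_smul (volume : Measure (EuclideanSpace ℝ (Fin d)))
    μH[(d : ℝ)], Measure.smul_apply, Measure.smul_apply]
  simp only [ENNReal.smul_def, smul_eq_mul]
  rw [mul_left_comm]
  gcongr
  simpa using hausdorffMeasure_image_le_of_dist_le h (s := d) (by positivity)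

end HausdorffComparison

section Tube

variable {k : ℕ}

/-- The proportionality constant of `exists_volume_tube_hyperplane`. -/
noncomputable def tubeConst (k : ℕ) : ℝ≥0∞ := (exists_volume_tube_hyperplane k).choose

lemma tubeConst_ne_top : tubeConst k ≠ ∞ := (exists_volume_tube_hyperplane k).choose_spec.1

lemma volume_tube_hyperplane {e : EuclideanSpace ℝ (Fin (k + 1))} (he : ‖e‖ = 1)
    {S : Set (EuclideanSpace ℝ (Fin (k + 1)))} (hS : ∀ p ∈ S, inner ℝ p e = 0) (ε : ℝ) :
    volume (tube (fun _ => e) S ε) = tubeConst k * μH[(k : ℝ)] S * ENNReal.ofReal ε :=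
  (exists_volume_tube_hyperplane k).choose_spec.2 e he S hS ε

variable {L θ ε : ℝ} {K : NNReal} {S A : Set (EuclideanSpace ℝ (Fin (k + 1)))}
  {n : EuclideanSpace ℝ (Fin (k + 1)) → EuclideanSpace ℝ (Fin (k + 1))}

lemma tube_comparison (hn : IsLipschitzNormal L S n) (hAS : A ⊆ S)
    (hA : ∀ x ∈ A, ∀ y ∈ A, L * ‖x - y‖ ≤ θ) (hε : L * ε ≤ θ) (hL : 0 ≤ L) (hθ0 : 0 ≤ θ)
    (hθ : θ ≤ 1 / 14) (hK : 1 ≤ K * (1 - 7 * θ)) :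
    volume (tube n A ε) ≤ K ^ (k + 1) * (tubeConst k * μH[(k : ℝ)] A * ENNReal.ofReal ε) ∧
    tubeConst k * μH[(k : ℝ)] A * ENNReal.ofReal ε ≤ K ^ (2 * k + 1) * volume (tube n A ε) := by
  rcases A.eq_empty_or_nonempty with rfl | ⟨x₀, hx₀⟩
  · simp [tube]
  have hK1 : 1 + 7 * θ ≤ K := by nlinarith
  have hK0 : (1 : ℝ) ≤ K := by linarith
  set e := n x₀
  have he : ‖e‖ = 1 := hn.norm_eq_one _ (hAS hx₀)
  set π : EuclideanSpace ℝ (Fin (k + 1)) → EuclideanSpace ℝ (Fin (k + 1)) :=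
    fun x => x - inner ℝ x e • e with hπ
  have hπ_sub : ∀ x y, π x - π y = (x - y) - inner ℝ (x - y) e • e := fun x y => by
    simp only [hπ, inner_sub_left]; module
  have hinner : ∀ x ∈ A, ∀ y ∈ A, |inner ℝ (x - y) e| ≤ 2 * θ * ‖x - y‖ := by
    intro x hx y hy
    have h1 := hn.abs_inner_le x (hAS hx) y (hAS hy)
    have h2 : |inner ℝ (x - y) (e - n y)| ≤ ‖x - y‖ * θ := by
      refine (abs_real_inner_le_norm _ _).trans ?_
      gcongr
      exact (hn.norm_sub_le _ (hAS hx₀) _ (hAS hy)).trans (hA _ hx₀ _ hy)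
    have h3 : inner ℝ (x - y) e = inner ℝ (x - y) (n y) + inner ℝ (x - y) (e - n y) := by
      rw [← inner_add_right]; congr 1; abel
    rw [h3]
    refine (abs_add_le _ _).trans ?_
    nlinarith [hA x hx y hy, norm_nonneg (x - y)]
  have hπ_le : ∀ x y, ‖π x - π y‖ ≤ ‖x - y‖ := fun x y => by
    have := norm_sub_inner_smul_add_sq he (x - y) (inner ℝ (x - y) e)
    rw [sub_add_cancel, ← hπ_sub] at this
    exact abs_le_of_sq_le_sq' (by nlinarith [sq_nonneg (inner ℝ (x - y) e)]) (norm_nonneg _) |>.2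
  have hπ_ge : ∀ x ∈ A, ∀ y ∈ A, ‖x - y‖ ≤ K * ‖π x - π y‖ := by
    intro x hx y hy
    have h1 : ‖x - y‖ ≤ ‖π x - π y‖ + |inner ℝ (x - y) e| := by
      calc ‖x - y‖ = ‖(π x - π y) + inner ℝ (x - y) e • e‖ := by rw [hπ_sub]; simp
        _ ≤ _ := (norm_add_le _ _).trans (by rw [norm_smul, he, Real.norm_eq_abs, mul_one])
    have h2 := hinner x hx y hy
    have h3 : (1 - 7 * θ) * ‖x - y‖ ≤ ‖π x - π y‖ := by nlinarith [norm_nonneg (x - y)]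
    calc ‖x - y‖ ≤ K * (1 - 7 * θ) * ‖x - y‖ := le_mul_of_one_le_left (norm_nonneg _) hK
      _ = K * ((1 - 7 * θ) * ‖x - y‖) := by ring
      _ ≤ _ := by gcongr
  set F : EuclideanSpace ℝ (Fin (k + 1)) × ℝ → EuclideanSpace ℝ (Fin (k + 1)) :=
    fun z => π z.1 + z.2 • e with hF
  set G : EuclideanSpace ℝ (Fin (k + 1)) × ℝ → EuclideanSpace ℝ (Fin (k + 1)) :=
    fun z => z.1 + z.2 • n z.1 with hG
  have hFG : ∀ z ∈ A ×ˢ Ioc 0 ε, ∀ z' ∈ A ×ˢ Ioc 0 ε,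
      ‖(G z - G z') - (F z - F z')‖ ≤ 7 * θ * ‖F z - F z'‖ := by
    rintro ⟨x, t⟩ ⟨hx, ht⟩ ⟨y, t'⟩ ⟨hy, ht'⟩
    have h1 : G (x, t) - G (y, t') = (x - y) + t • n x - t' • n y := by
      simp only [hG]; abel
    have h2 : F (x, t) - F (y, t') =
        (x - y) - inner ℝ (x - y) e • e + (t - t') • e := by
      rw [← hπ_sub]; simp only [hF]; module
    rw [h1, h2]
    refine norm_tube_sub_flat_le he (hn.norm_sub_le _ (hAS hx) _ (hAS hy))
      ((hn.norm_sub_le _ (hAS hy) _ (hAS hx₀)).trans (hA _ hy _ hx₀)) (hinner x hx y hy) ht.1.le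
      ((mul_le_mul_of_nonneg_left ht.2 hL).trans hε) (by linarith)
  have hF_image : F '' (A ×ˢ Ioc 0 ε) = tube (fun _ => e) (π '' A) ε := by
    ext y
    constructor
    · rintro ⟨⟨x, t⟩, ⟨hx, ht⟩, rfl⟩
      exact ⟨(π x, t), ⟨mem_image_of_mem _ hx, ht⟩, rfl⟩
    · rintro ⟨⟨_, t⟩, ⟨⟨x, hx, rfl⟩, ht⟩, rfl⟩
      exact ⟨(x, t), ⟨hx, ht⟩, rfl⟩
  have hflat : volume (F '' (A ×ˢ Ioc 0 ε)) =
      tubeConst k * μH[(k : ℝ)] (π '' A) * ENNReal.ofReal ε := by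
    rw [hF_image]
    refine volume_tube_hyperplane he ?_ ε
    rintro _ ⟨x, -, rfl⟩
    rw [hπ, inner_sub_left, real_inner_smul_left, real_inner_self_eq_norm_sq, he]
    ring
  have upper : volume (tube n A ε) ≤ K ^ (k + 1) * volume (F '' (A ×ˢ Ioc 0 ε)) := by
    refine volume_image_le_of_dist_le (G := G) fun z hz z' hz' => ?_
    rw [dist_eq_norm, dist_eq_norm]
    have h1 := hFG z hz z' hz'
    have h2 := norm_sub_norm_le (G z - G z') (F z - F z')
    nlinarith [norm_nonneg (F z - F z')]
  have lower : volume (F '' (A ×ˢ Ioc 0 ε)) ≤ K ^ (k + 1) * volume (tube n A ε) := by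
    refine volume_image_le_of_dist_le (G := F) (F := G) fun z hz z' hz' => ?_
    rw [dist_eq_norm, dist_eq_norm]
    have h1 := hFG z hz z' hz'
    have h2 := norm_le_norm_add_norm_sub (G z - G z') (F z - F z')
    have h3 : (1 - 7 * θ) * ‖F z - F z'‖ ≤ ‖G z - G z'‖ := by linarith
    calc ‖F z - F z'‖ ≤ K * (1 - 7 * θ) * ‖F z - F z'‖ :=
          le_mul_of_one_le_left (norm_nonneg _) hK
      _ = K * ((1 - 7 * θ) * ‖F z - F z'‖) := by ring
      _ ≤ _ := by gcongr
  rw [hflat] at upper lower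
  constructor
  · refine upper.trans ?_
    have : μH[(k : ℝ)] (π '' A) ≤ μH[(k : ℝ)] A := by
      simpa using hausdorffMeasure_image_le_of_dist_le (F := id) (G := π) (Z := A) (K := 1)
        (fun x _ y _ => by simpa [dist_eq_norm] using hπ_le x y) (s := k) (by positivity)
    gcongr
  · have : μH[(k : ℝ)] A ≤ K ^ k * μH[(k : ℝ)] (π '' A) := by
      simpa using hausdorffMeasure_image_le_of_dist_le (F := π) (G := id) (Z := A) (K := K)
        (fun x hx y hy => by simpa [dist_eq_norm] using hπ_ge x hx y hy) (s := k) (by positivity)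
    calc tubeConst k * μH[(k : ℝ)] A * ENNReal.ofReal ε
        ≤ tubeConst k * (K ^ k * μH[(k : ℝ)] (π '' A)) * ENNReal.ofReal ε := by gcongr
      _ = K ^ k * (tubeConst k * μH[(k : ℝ)] (π '' A) * ENNReal.ofReal ε) := by ring
      _ ≤ K ^ k * (K ^ (k + 1) * volume (tube n A ε)) := by gcongr
      _ = _ := by rw [← mul_assoc, ← pow_add]; congr 2; ring

end Tube

/-- A separable metric space splits into countably many disjoint measurable pieces of small
diameter. -/
lemma exists_measurable_partition_dist_le (X : Type*) [MetricSpace X]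
    [TopologicalSpace.SeparableSpace X] [Nonempty X] [MeasurableSpace X] [BorelSpace X] {η : ℝ}
    (hη : 0 < η) : ∃ P : ℕ → Set X, (∀ i, MeasurableSet (P i)) ∧ Pairwise (Function.onFun Disjoint P) ∧
      (⋃ i, P i) = univ ∧ ∀ i, ∀ x ∈ P i, ∀ y ∈ P i, dist x y ≤ η := by
  set Q : ℕ → Set X := fun i => ball (TopologicalSpace.denseSeq X i) (η / 2)
  refine ⟨disjointed Q, fun i => MeasurableSet.disjointed (fun _ => measurableSet_ball) i,
    disjoint_disjointed Q, ?_, fun i x hx y hy => ?_⟩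
  · rw [iUnion_disjointed, eq_univ_iff_forall]
    intro x
    obtain ⟨i, hi⟩ := (TopologicalSpace.denseRange_denseSeq X).exists_dist_lt x (half_pos hη)
    exact mem_iUnion.2 ⟨i, hi⟩
  · have h1 := disjointed_subset Q i hx
    have h2 := disjointed_subset Q i hy
    simp only [Q, mem_ball] at h1 h2
    linarith [dist_triangle_right x y (TopologicalSpace.denseSeq X i)]

section Tube

variable {k : ℕ} {L θ ε : ℝ} {K : NNReal} {S : Set (EuclideanSpace ℝ (Fin (k + 1)))}
  {n : EuclideanSpace ℝ (Fin (k + 1)) → EuclideanSpace ℝ (Fin (k + 1))}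

lemma volume_tube_le (hn : IsLipschitzNormal L S n) (hS : MeasurableSet S)
    (hε : L * ε ≤ θ) (hL : 0 < L) (hθ0 : 0 < θ) (hθ : θ ≤ 1 / 14) (hK : 1 ≤ K * (1 - 7 * θ)) :
    volume (tube n S ε) ≤ K ^ (k + 1) * (tubeConst k * μH[(k : ℝ)] S * ENNReal.ofReal ε) := by
  obtain ⟨P, hPm, hPd, hPu, hP⟩ := exists_measurable_partition_dist_le
    (EuclideanSpace ℝ (Fin (k + 1))) (div_pos hθ0 hL)
  have htube : tube n S ε ⊆ ⋃ i, tube n (S ∩ P i) ε := by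
    rintro _ ⟨⟨x, t⟩, ⟨hx, ht⟩, rfl⟩
    obtain ⟨i, hi⟩ := mem_iUnion.1 (hPu ▸ mem_univ x)
    exact mem_iUnion.2 ⟨i, (x, t), ⟨⟨hx, hi⟩, ht⟩, rfl⟩
  have hSsum : μH[(k : ℝ)] S = ∑' i, μH[(k : ℝ)] (S ∩ P i) := by
    rw [← measure_iUnion (fun i j hij => (hPd hij).mono inter_subset_right inter_subset_right)
      (fun i => hS.inter (hPm i)), ← inter_iUnion, hPu, inter_univ]
  calc volume (tube n S ε) ≤ ∑' i, volume (tube n (S ∩ P i) ε) :=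
        (measure_mono htube).trans (measure_iUnion_le _)
    _ ≤ ∑' i, K ^ (k + 1) * (tubeConst k * μH[(k : ℝ)] (S ∩ P i) * ENNReal.ofReal ε) := by
      refine ENNReal.tsum_le_tsum fun i => (tube_comparison hn inter_subset_left ?_ hε hL.le
        hθ0.le hθ hK).1
      intro x hx y hy
      rw [mul_comm, ← le_div_iff₀ hL, ← dist_eq_norm]
      exact hP i x hx.2 y hy.2
    _ = _ := by
      rw [ENNReal.tsum_mul_left, ENNReal.tsum_mul_right, ENNReal.tsum_mul_left, hSsum]

lemma hausdorffMeasure_le_volume_tube (hn : IsLipschitzNormal L S n) (hS : MeasurableSet S)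
    (hε : L * ε ≤ θ) (hL : 0 < L) (hθ0 : 0 < θ) (hθ : θ ≤ 1 / 14) (hK : 1 ≤ K * (1 - 7 * θ))
    {p : EuclideanSpace ℝ (Fin (k + 1)) → EuclideanSpace ℝ (Fin (k + 1))} (hp : Measurable p)
    {T : Set (EuclideanSpace ℝ (Fin (k + 1)))} (hT : MeasurableSet T) (hST : tube n S ε ⊆ T)
    (hpT : ∀ x ∈ S, ∀ t ∈ Ioc 0 ε, p (x + t • n x) = x) :
    tubeConst k * μH[(k : ℝ)] S * ENNReal.ofReal ε ≤ K ^ (2 * k + 1) * volume T := by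
  obtain ⟨P, hPm, hPd, hPu, hP⟩ := exists_measurable_partition_dist_le
    (EuclideanSpace ℝ (Fin (k + 1))) (div_pos hθ0 hL)
  have hSsum : μH[(k : ℝ)] S = ∑' i, μH[(k : ℝ)] (S ∩ P i) := by
    rw [← measure_iUnion (fun i j hij => (hPd hij).mono inter_subset_right inter_subset_right)
      (fun i => hS.inter (hPm i)), ← inter_iUnion, hPu, inter_univ]
  have hTsum : volume T = ∑' i, volume (T ∩ p ⁻¹' P i) := by
    rw [← measure_iUnion (fun i j hij => ((hPd hij).preimage p).mono inter_subset_right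
      inter_subset_right) (fun i => hT.inter (hp (hPm i))), ← inter_iUnion, ← preimage_iUnion, hPu,
      preimage_univ, inter_univ]
  rw [hSsum, hTsum, ← ENNReal.tsum_mul_left, ← ENNReal.tsum_mul_right, ← ENNReal.tsum_mul_left]
  refine ENNReal.tsum_le_tsum fun i => ((tube_comparison hn inter_subset_left ?_ hε hL.le
    hθ0.le hθ hK).2).trans ?_
  · intro x hx y hy
    rw [mul_comm, ← le_div_iff₀ hL, ← dist_eq_norm]
    exact hP i x hx.2 y hy.2
  · gcongr
    rintro _ ⟨⟨x, t⟩, ⟨hx, ht⟩, rfl⟩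
    refine ⟨hST ⟨(x, t), ⟨hx.1, ht⟩, rfl⟩, ?_⟩
    rw [mem_preimage, hpT x hx.1 t ht]
    exact hx.2

end Tube

/-- A field of unit vectors along `frontier E` for which the closed ball of radius `δ` touching from
the side of `-n x` lies in `E` and the open ball touching from the side of `n x` lies outside. -/
structure IsTangentBallNormal {E : Type*} [NormedAddCommGroup E] [InnerProductSpace ℝ E]
    (δ : ℝ) (A : Set E) (n : E → E) : Prop where
  norm_eq_one : ∀ x ∈ frontier A, ‖n x‖ = 1
  closedBall_subset : ∀ x ∈ frontier A, closedBall (x - δ • n x) δ ⊆ A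
  ball_subset_compl : ∀ x ∈ frontier A, ball (x + δ • n x) δ ⊆ Aᶜ

section TangentBalls

variable {E : Type*} [NormedAddCommGroup E] [InnerProductSpace ℝ E] {δ : ℝ} {A : Set E} {n : E → E}

lemma eq_of_add_norm_le_norm_add {a b : E} {s t : ℝ} (ha : ‖a‖ = t) (hb : ‖b‖ = 1) (hs : 0 < s)
    (ht : 0 ≤ t) (h : s + t ≤ ‖a + s • b‖) : a = t • b := by
  have h1 : (s + t) ^ 2 ≤ ‖a + s • b‖ ^ 2 := by gcongr
  rw [norm_add_sq_real, inner_smul_right, norm_smul, ha, hb, mul_one, Real.norm_eq_abs, sq_abs] at h1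
  have h2 : t ≤ inner ℝ a b := by nlinarith
  have h3 : ‖a - t • b‖ ^ 2 ≤ 0 := by
    rw [norm_sub_sq_real, inner_smul_right, norm_smul, ha, hb, mul_one, Real.norm_eq_abs, sq_abs]
    nlinarith
  rw [← sub_eq_zero, ← norm_eq_zero]
  exact pow_eq_zero_iff two_ne_zero |>.1 (le_antisymm h3 (sq_nonneg _))

lemma IsTangentBallNormal.isLipschitzNormal (h : IsTangentBallNormal δ A n) (hδ : 0 < δ)
    (hA : IsClosed A) : IsLipschitzNormal δ⁻¹ (frontier A) n := by
  refine ⟨h.norm_eq_one, fun x hx y hy => ?_, fun x hx y hy => ?_⟩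
  · have sep : ∀ x ∈ frontier A, ∀ y ∈ frontier A,
        (2 * δ) ^ 2 ≤ ‖(x - y) - δ • (n x + n y)‖ ^ 2 := fun x hx y hy => by
      have h1 : Disjoint (closedBall (x - δ • n x) δ) (ball (y + δ • n y) δ) :=
        disjoint_compl_right.mono (h.closedBall_subset x hx) (h.ball_subset_compl y hy)
      rw [disjoint_closedBall_ball_iff hδ.le hδ, dist_eq_norm] at h1
      have h2 : x - δ • n x - (y + δ • n y) = (x - y) - δ • (n x + n y) := by module
      rw [h2] at h1
      gcongr
      linarith
    have h1 := sep x hx y hy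
    have h2 := sep y hy x hx
    have h3 : (y - x) - δ • (n y + n x) = -((x - y) + δ • (n x + n y)) := by module
    rw [h3, norm_neg, norm_add_sq_real] at h2
    rw [norm_sub_sq_real] at h1
    have h4 : ‖n x + n y‖ ^ 2 + ‖n x - n y‖ ^ 2 = 4 := by
      rw [norm_add_sq_real, norm_sub_sq_real, h.norm_eq_one x hx, h.norm_eq_one y hy]; ring
    rw [norm_smul, Real.norm_eq_abs, abs_of_pos hδ, mul_pow] at h1 h2
    rw [inv_mul_eq_div, le_div_iff₀ hδ]
    refine abs_le_of_sq_le_sq' ?_ (norm_nonneg _) |>.2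
    nlinarith
  · have hb := h.norm_eq_one y hy
    have hxA : x ∈ A := hA.frontier_subset hx
    have h1 : δ ^ 2 ≤ ‖(x - y) + δ • n y‖ ^ 2 := by
      have h2 : x ∉ ball (y - δ • n y) δ := fun hmem =>
        hx.2 (interior_maximal (ball_subset_closedBall.trans (h.closedBall_subset y hy))
          isOpen_ball hmem)
      rw [mem_ball, not_lt, dist_eq_norm, sub_sub_eq_add_sub, add_sub_right_comm] at h2
      gcongr
    have h1' : δ ^ 2 ≤ ‖(x - y) - δ • n y‖ ^ 2 := by
      have h2 : x ∉ ball (y + δ • n y) δ := fun hmem => h.ball_subset_compl y hy hmem hxA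
      rw [mem_ball, not_lt, dist_eq_norm, ← sub_sub] at h2
      gcongr
    rw [norm_add_sq_real] at h1
    rw [norm_sub_sq_real] at h1'
    rw [norm_smul, Real.norm_eq_abs, abs_of_pos hδ, hb, mul_one, inner_smul_right] at h1 h1'
    rw [inv_mul_eq_div, abs_le, neg_le, le_div_iff₀ hδ, le_div_iff₀ hδ]
    constructor <;> nlinarith [sq_nonneg ‖x - y‖]

lemma IsTangentBallNormal.thickening_subset [FiniteDimensional ℝ E]
    (h : IsTangentBallNormal δ A n) (hδ : 0 < δ) (hA : IsClosed A) (hA0 : A.Nonempty) (ε : ℝ) :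
    thickening ε A ⊆ A ∪ tube n (frontier A) ε := by
  intro y hy
  by_cases hyA : y ∈ A
  · exact Or.inl hyA
  right
  have : ProperSpace E := FiniteDimensional.proper ℝ E
  obtain ⟨x, hxA, hxy⟩ := hA.exists_infDist_eq_dist hA0 y
  rw [mem_thickening_iff_infDist_lt hA0, hxy] at hy
  have ht : 0 < dist y x := dist_pos.2 fun h => hyA (h ▸ hxA)
  have hball : ball y (dist y x) ⊆ Aᶜ := fun z hz hzA => by
    rw [mem_ball'] at hz
    exact (infDist_le_dist_of_mem hzA).not_gt (hxy ▸ hz)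
  have hx : x ∈ frontier A := by
    rw [frontier_eq_closure_inter_closure]
    refine ⟨subset_closure hxA, closure_mono hball ?_⟩
    rw [closure_ball _ ht.ne', mem_closedBall']
  have h1 : Disjoint (closedBall (x - δ • n x) δ) (ball y (dist y x)) :=
    disjoint_compl_right.mono (h.closedBall_subset x hx) hball
  rw [disjoint_closedBall_ball_iff hδ.le ht, dist_comm (x - δ • n x), dist_eq_norm _ (x - δ • n x),
    ← sub_add] at h1
  refine ⟨(x, dist y x), ⟨hx, ht, hy.le⟩, ?_⟩
  have := eq_of_add_norm_le_norm_add (dist_eq_norm y x).symm (h.norm_eq_one x hx) hδ ht.le h1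
  simp only [← this]
  abel

lemma frontier_inter_subset_of_subset_union {X : Type*} [TopologicalSpace X] {A u v : Set X}
    (hA : IsClosed A) (hu : IsClosed u) (hv : IsClosed v) (huv : Disjoint u v) (hAuv : A ⊆ u ∪ v) :
    frontier (A ∩ u) ⊆ frontier A := by
  intro x hx
  have hxA := (hA.inter hu).frontier_subset hx
  refine ⟨subset_closure hxA.1, fun hxi => hx.2 ?_⟩
  refine interior_maximal (t := interior A ∩ vᶜ) ?_ (isOpen_interior.inter hv.isOpen_compl)
    ⟨hxi, fun hxv => disjoint_left.1 huv hxA.2 hxv⟩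
  rintro z ⟨hz, hzv⟩
  exact ⟨interior_subset hz, (hAuv (interior_subset hz)).resolve_right hzv⟩

lemma IsTangentBallNormal.inter (h : IsTangentBallNormal δ A n) (hδ : 0 < δ) (hA : IsClosed A)
    {u v : Set E} (hu : IsClosed u) (hv : IsClosed v) (huv : Disjoint u v) (hAuv : A ⊆ u ∪ v) :
    IsTangentBallNormal δ (A ∩ u) n := by
  have hf := frontier_inter_subset_of_subset_union hA hu hv huv hAuv
  refine ⟨fun x hx => h.norm_eq_one x (hf hx), fun x hx => ?_, fun x hx =>
    (h.ball_subset_compl x (hf hx)).trans (compl_subset_compl.2 inter_subset_left)⟩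
  have hb := h.closedBall_subset x (hf hx)
  refine subset_inter hb ?_
  have hpre : IsPreconnected (closedBall (x - δ • n x) δ) :=
    (convex_closedBall _ _).isPreconnected
  refine (isPreconnected_iff_subset_of_disjoint_closed.1 hpre u v hu hv (hb.trans hAuv)
    (by rw [huv.inter_eq, inter_empty])).resolve_right fun hbv => ?_
  refine disjoint_left.1 huv ((hA.inter hu).frontier_subset hx).2 (hbv ?_)
  rw [mem_closedBall, dist_eq_norm, _root_.sub_sub_cancel, norm_smul, h.norm_eq_one x (hf hx),
    Real.norm_eq_abs, abs_of_pos hδ, mul_one]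

lemma isTangentBallNormal_closedBall {r : ℝ} (hr : 0 < r) :
    IsTangentBallNormal r (closedBall (0 : E) r) (fun x => r⁻¹ • x) := by
  have hx0 : ∀ x ∈ frontier (closedBall (0 : E) r), ‖x‖ = r := fun x hx => by
    rw [frontier_closedBall _ hr.ne'] at hx
    simpa using hx
  refine ⟨fun x hx => ?_, fun x _ => ?_, fun x hx y hy hyr => ?_⟩
  · rw [norm_smul, hx0 x hx, norm_inv, Real.norm_eq_abs, abs_of_pos hr, inv_mul_cancel₀ hr.ne']
  · rw [smul_inv_smul₀ hr.ne', sub_self]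
  · rw [smul_inv_smul₀ hr.ne', mem_ball, dist_eq_norm] at hy
    rw [mem_closedBall_zero_iff] at hyr
    have h1 : ‖x + x‖ = 2 * r := by rw [← two_smul ℝ x, norm_smul, hx0 x hx]; simp
    have h2 := norm_le_norm_add_norm_sub y (x + x)
    linarith

end TangentBalls

lemma BallCond.exists_isTangentBallNormal {d : ℕ} {δ : ℝ} {A : Set (EuclideanSpace ℝ (Fin d))}
    (h : BallCond δ A) (hδ : 0 < δ) : ∃ n, IsTangentBallNormal δ A n := by
  have key : ∀ x, ∃ e, x ∈ frontier A → ‖e‖ = 1 ∧ closedBall (x - δ • e) δ ⊆ A ∧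
      ball (x + δ • e) δ ⊆ Aᶜ := by
    intro x
    by_cases hx : x ∈ frontier A
    swap
    · exact ⟨0, fun h => absurd h hx⟩
    obtain ⟨⟨y, hxy, hy⟩, z, hxz, hz⟩ := h x hx
    rw [mem_sphere_iff_norm] at hxy hxz
    have hsep : Disjoint (closedBall y δ) (ball z δ) := disjoint_compl_right.mono hy hz
    rw [disjoint_closedBall_ball_iff hδ.le hδ, dist_comm, dist_eq_norm] at hsep
    have he : ‖δ⁻¹ • (x - y)‖ = 1 := by
      rw [norm_smul, hxy, norm_inv, Real.norm_eq_abs, abs_of_pos hδ, inv_mul_cancel₀ hδ.ne']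
    have hzx := eq_of_add_norm_le_norm_add (a := z - x) (b := δ⁻¹ • (x - y)) (s := δ) (t := δ)
      (by rw [norm_sub_rev, hxz]) he hδ hδ.le (by
        rwa [smul_inv_smul₀ hδ.ne', sub_add_sub_cancel])
    rw [smul_inv_smul₀ hδ.ne'] at hzx
    refine ⟨δ⁻¹ • (x - y), fun _ => ⟨he, ?_, ?_⟩⟩
    · rwa [smul_inv_smul₀ hδ.ne', _root_.sub_sub_cancel]
    · rwa [smul_inv_smul₀ hδ.ne', ← hzx, add_sub_cancel]
  choose n hn using key
  exact ⟨n, fun x hx => (hn x hx).1, fun x hx => (hn x hx).2.1, fun x hx => (hn x hx).2.2⟩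

lemma ENNReal.le_of_forall_one_lt_le_pow_mul {c M : ℝ≥0∞} {N : ℕ}
    (h : ∀ K : NNReal, 1 < K → c ≤ K ^ N * M) : c ≤ M := by
  rcases eq_or_ne M ∞ with rfl | hM
  · exact le_top
  have hlim : Tendsto (fun K : NNReal => (K : ℝ≥0∞) ^ N * M) (nhdsWithin 1 (Ioi 1)) (nhds M) := by
    have h1 : Tendsto (fun K : NNReal => (K : ℝ≥0∞) ^ N) (nhds 1) (nhds 1) := by
      have : Continuous fun K : NNReal => ((K ^ N : NNReal) : ℝ≥0∞) :=
        ENNReal.continuous_coe.comp (continuous_pow N)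
      simpa using this.tendsto 1
    simpa using ENNReal.Tendsto.mul_const (h1.mono_left nhdsWithin_le_nhds) (Or.inr hM)
  exact ge_of_tendsto hlim (eventually_nhdsWithin_of_forall h)

lemma exists_one_le_mul_one_sub {K : NNReal} (hK : 1 < K) :
    ∃ θ : ℝ, 0 < θ ∧ θ ≤ 1 / 14 ∧ 1 ≤ K * (1 - 7 * θ) := by
  have hK' : (1 : ℝ) < K := hK
  have h0 : 0 < 1 - (K : ℝ)⁻¹ := sub_pos.2 (inv_lt_one_of_one_lt₀ hK')
  refine ⟨min (1 / 14) ((1 - (K : ℝ)⁻¹) / 7), by positivity, min_le_left _ _, ?_⟩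
  have h1 : (K : ℝ)⁻¹ ≤ 1 - 7 * min (1 / 14) ((1 - (K : ℝ)⁻¹) / 7) := by
    linarith [min_le_right (1 / 14) ((1 - (K : ℝ)⁻¹) / 7)]
  calc (1 : ℝ) = K * (K : ℝ)⁻¹ := (mul_inv_cancel₀ (by positivity)).symm
    _ ≤ _ := by gcongr

section Isoperimetric

variable {k : ℕ} {A : Set (EuclideanSpace ℝ (Fin (k + 1)))}
  {n : EuclideanSpace ℝ (Fin (k + 1)) → EuclideanSpace ℝ (Fin (k + 1))} {δ u w r ω : ℝ}

/-- The isoperimetric inequality for closed sets with tangent balls. -/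
lemma IsTangentBallNormal.isoperimetric (h : IsTangentBallNormal δ A n) (hδ : 0 < δ)
    (hA : IsClosed A) (hu : 0 < u) (hw : 0 < w) (hAu : volume A = ENNReal.ofReal (u ^ (k + 1)))
    (hBw : volume (ball (0 : EuclideanSpace ℝ (Fin (k + 1))) 1) = ENNReal.ofReal (w ^ (k + 1))) :
    ENNReal.ofReal ((k + 1) * w * u ^ k) ≤ tubeConst k * μH[(k : ℝ)] (frontier A) := by
  refine ENNReal.le_of_forall_one_lt_le_pow_mul (N := k + 1) fun K hK => ?_
  obtain ⟨θ, hθ0, hθ, hKθ⟩ := exists_one_le_mul_one_sub hK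
  have hA0 : A.Nonempty := nonempty_of_measure_ne_zero (μ := volume) (by
    rw [hAu]; exact (ENNReal.ofReal_pos.2 (by positivity)).ne')
  have hε : 0 < θ * δ := by positivity
  have h1 := add_pow_le_volume_thickening hA.measurableSet hu hw hε hAu hBw
  have h2 := volume_tube_le (h.isLipschitzNormal hδ hA) isClosed_frontier.measurableSet
    (ε := θ * δ) (by field_simp; rfl) (by positivity) hθ0 hθ hKθ
  have h3 : u ^ (k + 1) + (k + 1) * w * u ^ k * (θ * δ) ≤ (u + θ * δ * w) ^ (k + 1) := by
    have hb := one_add_mul_le_pow (a := θ * δ * w / u) (by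
      have : 0 < θ * δ * w / u := by positivity
      linarith) (k + 1)
    calc u ^ (k + 1) + (k + 1) * w * u ^ k * (θ * δ)
        = u ^ (k + 1) * (1 + (k + 1 : ℕ) * (θ * δ * w / u)) := by
          push_cast; field_simp; ring
      _ ≤ u ^ (k + 1) * (1 + θ * δ * w / u) ^ (k + 1) := by gcongr
      _ = _ := by rw [← mul_pow]; congr 1; field_simp
  have h4 : volume A + ENNReal.ofReal ((k + 1) * w * u ^ k) * ENNReal.ofReal (θ * δ) ≤
      volume A + K ^ (k + 1) * (tubeConst k * μH[(k : ℝ)] (frontier A)) *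
        ENNReal.ofReal (θ * δ) := by
    calc volume A + ENNReal.ofReal ((k + 1) * w * u ^ k) * ENNReal.ofReal (θ * δ)
        = ENNReal.ofReal (u ^ (k + 1) + (k + 1) * w * u ^ k * (θ * δ)) := by
          rw [hAu, ← ENNReal.ofReal_mul (by positivity),
            ENNReal.ofReal_add (by positivity) (by positivity)]
      _ ≤ volume (thickening (θ * δ) A) := (ENNReal.ofReal_le_ofReal h3).trans h1
      _ ≤ volume A + volume (tube n (frontier A) (θ * δ)) :=
        (measure_mono (h.thickening_subset hδ hA hA0 _)).trans (measure_union_le _ _)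
      _ ≤ _ := by rw [mul_assoc]; gcongr
  have h5 := (ENNReal.add_le_add_iff_left (by rw [hAu]; exact ENNReal.ofReal_ne_top)).1 h4
  exact (ENNReal.mul_le_mul_iff_left (ENNReal.ofReal_pos.2 hε).ne' ENNReal.ofReal_ne_top).1 h5

lemma tubeConst_mul_hausdorffMeasure_frontier_closedBall_le (hr : 0 < r) (hω : 0 < ω)
    (hBω : volume (ball (0 : EuclideanSpace ℝ (Fin (k + 1))) 1) = ENNReal.ofReal ω) :
    tubeConst k * μH[(k : ℝ)] (frontier (closedBall (0 : EuclideanSpace ℝ (Fin (k + 1))) r)) ≤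
      ENNReal.ofReal ((k + 1) * ω * r ^ k) := by
  refine ENNReal.le_of_forall_one_lt_le_pow_mul (N := 2 * k + 1 + k) fun K hK => ?_
  obtain ⟨θ, hθ0, hθ, hKθ⟩ := exists_one_le_mul_one_sub hK
  have hK' : (1 : ℝ) < K := hK
  set ε := min (θ * r) ((K - 1) * r) with hε_def
  have hε : 0 < ε := lt_min (by positivity) (mul_pos (by linarith) hr)
  have hεθ : ε ≤ θ * r := min_le_left _ _
  have hεK : r + ε ≤ K * r := by linarith [min_le_right (θ * r) ((K - 1) * r)]
  have hvol : ∀ s : ℝ, 0 ≤ s → volume (closedBall (0 : EuclideanSpace ℝ (Fin (k + 1))) s) =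
      ENNReal.ofReal (ω * s ^ (k + 1)) := fun s hs => by
    rw [Measure.addHaar_closedBall _ _ hs, hBω, finrank_euclideanSpace_fin, mul_comm,
      ENNReal.ofReal_mul hω.le]
  set T := closedBall (0 : EuclideanSpace ℝ (Fin (k + 1))) (r + ε) \ closedBall 0 r
  have hT : volume T ≤ K ^ k * ENNReal.ofReal ((k + 1) * ω * r ^ k) * ENNReal.ofReal ε := by
    rw [measure_sdiff (closedBall_subset_closedBall (by linarith))
      measurableSet_closedBall.nullMeasurableSet measure_closedBall_lt_top.ne,
      hvol _ (by positivity), hvol _ hr.le, ← ENNReal.ofReal_sub _ (by positivity),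
      ← ENNReal.ofReal_coe_nnreal, ← ENNReal.ofReal_pow (by positivity),
      ← ENNReal.ofReal_mul (by positivity), ← ENNReal.ofReal_mul (by positivity)]
    refine ENNReal.ofReal_le_ofReal ?_
    have h1 := (le_abs_self _).trans (abs_pow_sub_pow_le (r + ε) r (k + 1))
    rw [add_sub_cancel_left, abs_of_pos hε, abs_of_pos hr, abs_of_pos (by positivity : 0 < r + ε),
      max_eq_left (by linarith), Nat.add_sub_cancel] at h1
    push_cast at h1
    have h2 : (r + ε) ^ k ≤ K ^ k * r ^ k := by rw [← mul_pow]; gcongr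
    calc ω * (r + ε) ^ (k + 1) - ω * r ^ (k + 1)
        = ω * ((r + ε) ^ (k + 1) - r ^ (k + 1)) := by ring
      _ ≤ ω * (ε * (k + 1) * (K ^ k * r ^ k)) := by
        refine mul_le_mul_of_nonneg_left (h1.trans ?_) hω.le
        gcongr
      _ = _ := by ring
  have hn := isTangentBallNormal_closedBall (E := EuclideanSpace ℝ (Fin (k + 1))) hr
  have hx0 : ∀ x ∈ frontier (closedBall (0 : EuclideanSpace ℝ (Fin (k + 1))) r), ‖x‖ = r :=
    fun x hx => by
      rw [frontier_closedBall _ hr.ne'] at hx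
      simpa using hx
  have hnorm : ∀ x ∈ frontier (closedBall (0 : EuclideanSpace ℝ (Fin (k + 1))) r), ∀ t > 0,
      ‖x + t • r⁻¹ • x‖ = r + t := fun x hx t ht => by
    have : x + t • r⁻¹ • x = (1 + t * r⁻¹) • x := by module
    rw [this, norm_smul, hx0 x hx, Real.norm_eq_abs, abs_of_pos (by positivity)]
    field_simp
  have main := hausdorffMeasure_le_volume_tube (hn.isLipschitzNormal hr isClosed_closedBall)
    isClosed_frontier.measurableSet (ε := ε) (by rw [inv_mul_eq_div, div_le_iff₀ hr]; exact hεθ)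
    (by positivity) hθ0 hθ hKθ (p := fun y => (r / ‖y‖) • y) (T := T) (by fun_prop)
    (measurableSet_closedBall.diff measurableSet_closedBall) (by
      rintro _ ⟨⟨x, t⟩, ⟨hx, ht⟩, rfl⟩
      have := hnorm x hx t ht.1
      refine ⟨?_, ?_⟩
      · rw [mem_closedBall_zero_iff, this]
        linarith [ht.2]
      · rw [mem_closedBall_zero_iff, this, not_le]
        linarith [ht.1]) (fun x hx t ht => by
      have ht0 := ht.1
      rw [hnorm x hx t ht.1]
      have : x + t • r⁻¹ • x = (1 + t * r⁻¹) • x := by module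
      rw [this, smul_smul]
      have : r / (r + t) * (1 + t * r⁻¹) = 1 := by field_simp
      rw [this, one_smul])
  have h6 := main.trans (mul_le_mul_right hT _)
  rw [← mul_assoc, ← mul_assoc, ← pow_add] at h6
  exact (ENNReal.mul_le_mul_iff_left (ENNReal.ofReal_pos.2 hε).ne' ENNReal.ofReal_ne_top).1 h6

lemma IsTangentBallNormal.ofReal_le_volume (h : IsTangentBallNormal δ A n) (hδ : 0 < δ)
    (hA : A.Nonempty) (hAv : volume A ≠ ∞)
    (hBω : volume (ball (0 : EuclideanSpace ℝ (Fin (k + 1))) 1) = ENNReal.ofReal ω) :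
    ENNReal.ofReal (ω * δ ^ (k + 1)) ≤ volume A := by
  have hA' : A ≠ univ := by
    rintro rfl
    exact hAv (measure_univ_of_isAddLeftInvariant volume)
  obtain ⟨x, hx⟩ := nonempty_frontier_iff.2 ⟨hA, hA'⟩
  refine le_trans (le_of_eq ?_) (measure_mono (h.closedBall_subset x hx))
  rw [Measure.addHaar_closedBall _ _ hδ.le, hBω, finrank_euclideanSpace_fin, mul_comm,
    ENNReal.ofReal_mul (by positivity)]

end Isoperimetric

section Final

lemma one_add_pow_mul_one_sub_le {k : ℕ} {x y : ℝ} (hx : 0 ≤ x) (hy : 0 ≤ y)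
    (hxy : x ^ (k + 1) + y ^ (k + 1) = 1) : 1 + x ^ k * (1 - x) ≤ x ^ k + y ^ k := by
  have hy1 : y ≤ 1 := by
    by_contra! h
    have : 1 < y ^ (k + 1) := one_lt_pow₀ h (Nat.succ_ne_zero k)
    have := pow_nonneg hx (k + 1)
    linarith
  have : y ^ (k + 1) ≤ y ^ k := pow_le_pow_of_le_one hy hy1 (Nat.le_succ k)
  calc 1 + x ^ k * (1 - x) = x ^ k + y ^ (k + 1) := by linear_combination -hxy
    _ ≤ _ := by gcongr

/-- Quantitative concavity: cutting a unit mass into two pieces of linear size at least `s` raises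
the sum of the isoperimetric lower bounds. -/
lemma one_add_pow_lt_pow_add_pow {k : ℕ} {x y s c : ℝ} (hs : 0 < s) (hsx : s ≤ x) (hsy : s ≤ y)
    (hxy : x ^ (k + 1) + y ^ (k + 1) = 1) (hc : c < 1 / (2 * (k + 1))) :
    1 + c * s ^ (2 * (k + 1)) < x ^ k + y ^ k := by
  wlog h : x ≤ y generalizing x y
  · rw [add_comm (x ^ k)]
    exact this hsy hsx (by rw [← hxy]; ring) (by linarith)
  have hx : 0 < x := hs.trans_le hsx
  have hx2 : x ^ (k + 1) ≤ 1 / 2 := by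
    have : x ^ (k + 1) ≤ y ^ (k + 1) := by gcongr
    linarith
  have hbern : 1 - (k + 1) * (1 - x) ≤ x ^ (k + 1) := by
    have := one_add_mul_sub_le_pow (a := x) (by linarith) (k + 1)
    push_cast at this
    linarith
  have hx1 : 1 / (2 * ((k : ℝ) + 1)) ≤ 1 - x := by
    rw [div_le_iff₀ (by positivity)]
    linarith
  have hx1' : x ≤ 1 := by
    have : 0 < 1 / (2 * ((k : ℝ) + 1)) := by positivity
    linarith
  have hsk : s ^ (2 * (k + 1)) ≤ x ^ k :=
    (pow_le_pow_of_le_one hs.le (hsx.trans hx1') (by omega : k ≤ 2 * (k + 1))).trans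
      (by gcongr)
  have hpos : 0 < s ^ (2 * (k + 1)) := by positivity
  refine lt_of_lt_of_le ?_ (one_add_pow_mul_one_sub_le hx.le (hx.le.trans h) hxy)
  gcongr 1 + ?_
  calc c * s ^ (2 * (k + 1)) < 1 / (2 * (k + 1)) * s ^ (2 * (k + 1)) := by gcongr
    _ ≤ (1 - x) * x ^ k := by gcongr
    _ = _ := mul_comm _ _

lemma sq_mul_rpow_le_of_div_le {k : ℕ} {α δ U w Q Q₀ : ℝ} (hδ : 0 < δ) (hU : 0 < U) (hw : 0 < w)
    (hQ : 0 < Q)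
    (h : Q / (U ^ (k + 1)) ^ ((k + α) / (2 * (k + 1))) ≤ Q₀ * δ ^ (k + 1) / U ^ (k + 1)) :
    Q ^ 2 * (U / w) ^ (-α) ≤ Q₀ ^ 2 * (δ / U) ^ (2 * (k + 1)) * U ^ k * w ^ α := by
  have h1 : (U ^ (k + 1)) ^ (((k : ℝ) + α) / (2 * (k + 1))) = U ^ (((k : ℝ) + α) / 2) := by
    rw [← Real.rpow_natCast, ← Real.rpow_mul hU.le]
    congr 1
    push_cast
    field_simp
  rw [h1, div_le_iff₀ (by positivity)] at h
  have h2 : Q ^ 2 ≤ (Q₀ * δ ^ (k + 1) / U ^ (k + 1) * U ^ (((k : ℝ) + α) / 2)) ^ 2 := by gcongr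
  have h3 : (U ^ (((k : ℝ) + α) / 2)) ^ 2 = U ^ k * U ^ α := by
    rw [← Real.rpow_natCast, ← Real.rpow_mul hU.le, ← Real.rpow_natCast, ← Real.rpow_add hU]
    congr 1
    push_cast
    field_simp
  have h4 : (U / w) ^ (-α) = (U ^ α)⁻¹ * w ^ α := by
    rw [Real.rpow_neg (by positivity), Real.div_rpow hU.le hw.le, inv_div, div_eq_inv_mul]
  rw [mul_pow, h3] at h2
  have hUα : 0 < U ^ α := by positivity
  have hwα : 0 < w ^ α := by positivity
  calc Q ^ 2 * (U / w) ^ (-α)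
      ≤ (Q₀ * δ ^ (k + 1) / U ^ (k + 1)) ^ 2 * (U ^ k * U ^ α) * ((U ^ α)⁻¹ * w ^ α) := by
        rw [h4]; gcongr
    _ = (Q₀ * δ ^ (k + 1) / U ^ (k + 1)) ^ 2 * U ^ k * w ^ α := by field_simp
    _ = _ := by rw [mul_div_assoc, ← div_pow, mul_pow, ← pow_mul, mul_comm (k + 1)]

lemma isPreconnected_of_fen_le {k : ℕ} {α δ Q U w D : ℝ} {C : ℝ≥0∞}
    {A : Set (EuclideanSpace ℝ (Fin (k + 1)))} (hδ : 0 < δ) (hU : 0 < U) (hw : 0 < w)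
    (hBw : volume (ball (0 : EuclideanSpace ℝ (Fin (k + 1))) 1) = ENNReal.ofReal (w ^ (k + 1)))
    (hC : rieszEnergy α (closedBall (0 : EuclideanSpace ℝ (Fin (k + 1))) (U / w)) ≤
      ENNReal.ofReal ((U / w) ^ (-α)) * C) (hD : tubeConst k * C = ENNReal.ofReal D) (hD0 : 0 ≤ D)
    (hA : IsClosed A) (hAU : volume A = ENNReal.ofReal (U ^ (k + 1))) (hAδ : BallCond δ A)
    (hF : Fen α Q A ≤ Fen α Q (closedBall (0 : EuclideanSpace ℝ (Fin (k + 1))) (U / w)))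
    {c : ℝ} (hc : c < 1 / (2 * (k + 1)))
    (hQ : Q ^ 2 * (U / w) ^ (-α) * D ≤
      (k + 1) * w * U ^ k * (c * (w * δ / U) ^ (2 * (k + 1)))) :
    IsPreconnected A := by
  obtain ⟨n, hn⟩ := hAδ.exists_isTangentBallNormal hδ
  by_contra hcon
  rw [isPreconnected_iff_subset_of_fully_disjoint_closed hA] at hcon
  push Not at hcon
  obtain ⟨u, v, hu, hv, hAuv, huv, hAu, hAv⟩ := hcon
  have hfin : volume A ≠ ∞ := by rw [hAU]; exact ENNReal.ofReal_ne_top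
  have piece : ∀ u v : Set (EuclideanSpace ℝ (Fin (k + 1))), IsClosed u → IsClosed v →
      A ⊆ u ∪ v → Disjoint u v → ¬ A ⊆ v → ∃ x : ℝ, w * δ ≤ x ∧
      volume (A ∩ u) = ENNReal.ofReal (x ^ (k + 1)) ∧
      ENNReal.ofReal ((k + 1) * w * x ^ k) ≤ tubeConst k * μH[(k : ℝ)] (frontier (A ∩ u)) := by
    intro u v hu hv hAuv huv hAv
    have hn' := hn.inter hδ hA hu hv huv hAuv
    have hne : (A ∩ u).Nonempty := by
      obtain ⟨x, hxA, hxv⟩ := not_subset.1 hAv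
      exact ⟨x, hxA, (hAuv hxA).resolve_right hxv⟩
    have hfin' : volume (A ∩ u) ≠ ∞ := measure_ne_top_of_subset inter_subset_left hfin
    have hle := hn'.ofReal_le_volume hδ hne hfin' hBw
    rw [← mul_pow, ENNReal.ofReal_le_iff_le_toReal hfin'] at hle
    set y := (volume (A ∩ u)).toReal
    have hwδ : 0 < w * δ := by positivity
    have hy : 0 ≤ y := toReal_nonneg
    have hx : (y ^ ((k + 1 : ℕ) : ℝ)⁻¹) ^ (k + 1) = y := Real.rpow_inv_natCast_pow hy (by omega)
    have hx0 : 0 ≤ y ^ ((k + 1 : ℕ) : ℝ)⁻¹ := by positivity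
    have hxδ : w * δ ≤ y ^ ((k + 1 : ℕ) : ℝ)⁻¹ := by
      refine le_of_pow_le_pow_left₀ (n := k + 1) (by omega) hx0 ?_
      rwa [hx]
    have hvol : volume (A ∩ u) = ENNReal.ofReal ((y ^ ((k + 1 : ℕ) : ℝ)⁻¹) ^ (k + 1)) := by
      rw [hx, ENNReal.ofReal_toReal hfin']
    exact ⟨_, hxδ, hvol, hn'.isoperimetric hδ (hA.inter hu) (hwδ.trans_le hxδ) hw hvol hBw⟩
  obtain ⟨x, hxδ, hxv, hxP⟩ := piece u v hu hv hAuv huv hAv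
  obtain ⟨y, hyδ, hyv, hyP⟩ := piece v u hv hu (union_comm u v ▸ hAuv) huv.symm hAu
  have hwδ : 0 < w * δ := by positivity
  have hx0 : 0 < x := hwδ.trans_le hxδ
  have hy0 : 0 < y := hwδ.trans_le hyδ
  have hsum : x ^ (k + 1) + y ^ (k + 1) = U ^ (k + 1) := by
    have h1 : volume A = volume (A ∩ u) + volume (A ∩ v) := by
      rw [← measure_union (huv.mono inter_subset_right inter_subset_right)
        (hA.inter hv).measurableSet, ← inter_union_distrib_left, inter_eq_left.2 hAuv]
    rw [hAU, hxv, hyv, ← ENNReal.ofReal_add (by positivity) (by positivity),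
      ENNReal.ofReal_eq_ofReal_iff (by positivity) (by positivity)] at h1
    exact h1.symm
  have hP : μH[(k : ℝ)] (frontier (A ∩ u)) + μH[(k : ℝ)] (frontier (A ∩ v)) ≤
      μH[(k : ℝ)] (frontier A) := by
    rw [← measure_union (huv.mono ((hA.inter hu).frontier_subset.trans inter_subset_right)
      ((hA.inter hv).frontier_subset.trans inter_subset_right)) isClosed_frontier.measurableSet]
    exact measure_mono (union_subset (frontier_inter_subset_of_subset_union hA hu hv huv hAuv)
      (frontier_inter_subset_of_subset_union hA hv hu huv.symm (union_comm u v ▸ hAuv)))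
  have hdim : ((k + 1 : ℕ) : ℝ) - 1 = k := by push_cast; ring
  rw [Fen, Fen, hdim] at hF
  have hball := tubeConst_mul_hausdorffMeasure_frontier_closedBall_le (r := U / w)
    (by positivity) (by positivity) hBw
  have key : ENNReal.ofReal ((k + 1) * w * x ^ k + (k + 1) * w * y ^ k) ≤
      ENNReal.ofReal ((k + 1) * w ^ (k + 1) * (U / w) ^ k + Q ^ 2 * (U / w) ^ (-α) * D) := by
    rw [ENNReal.ofReal_add (by positivity) (by positivity),
      ENNReal.ofReal_add (by positivity) (by positivity),
      ENNReal.ofReal_mul' hD0, ENNReal.ofReal_mul (sq_nonneg Q), ← hD]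
    calc _ ≤ tubeConst k * μH[(k : ℝ)] (frontier (A ∩ u)) +
          tubeConst k * μH[(k : ℝ)] (frontier (A ∩ v)) := add_le_add hxP hyP
      _ ≤ tubeConst k * (μH[(k : ℝ)] (frontier A) + ENNReal.ofReal (Q ^ 2) * rieszEnergy α A) := by
        rw [← mul_add]
        exact mul_le_mul_right (hP.trans le_self_add) _
      _ ≤ tubeConst k * (μH[(k : ℝ)] (frontier (closedBall
            (0 : EuclideanSpace ℝ (Fin (k + 1))) (U / w))) + ENNReal.ofReal (Q ^ 2) *
            (ENNReal.ofReal ((U / w) ^ (-α)) * C)) := by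
        exact mul_le_mul_right (hF.trans (by gcongr)) _
      _ = tubeConst k * μH[(k : ℝ)] (frontier (closedBall
            (0 : EuclideanSpace ℝ (Fin (k + 1))) (U / w))) + ENNReal.ofReal (Q ^ 2) *
            ENNReal.ofReal ((U / w) ^ (-α)) * (tubeConst k * C) := by ring
      _ ≤ _ := by gcongr
  rw [ENNReal.ofReal_le_ofReal_iff (by positivity)] at key
  have hball' : (k + 1) * w ^ (k + 1) * (U / w) ^ k = (k + 1) * w * U ^ k := by
    rw [div_pow, pow_succ]; field_simp
  have hlt := one_add_pow_lt_pow_add_pow (k := k) (x := x / U) (y := y / U) (s := w * δ / U)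
    (by positivity) (by gcongr) (by gcongr)
    (by rw [div_pow, div_pow, ← add_div, hsum, div_self (by positivity)]) hc
  have hscale : (k + 1) * w * U ^ k * ((x / U) ^ k + (y / U) ^ k) =
      (k + 1) * w * x ^ k + (k + 1) * w * y ^ k := by
    rw [div_pow, div_pow]; field_simp
  have := mul_lt_mul_of_pos_left hlt (by positivity : 0 < (k + 1) * w * U ^ k)
  rw [hscale] at this
  rw [hball'] at key
  linarith

end Final

/-- For small charge, any set in `K_δ` of volume `m` whose energy does not exceed that of
the ball of volume `m` is connected. -/
theorem connected_of_small_charge {d : ℕ} (hd : 2 ≤ d) (α : ℝ)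
    (hα0 : 0 < α) (hαd : α < (d : ℝ) - 1) :
    ∃ Q₀ : ℝ, 0 < Q₀ ∧
      ∀ δ m Q : ℝ, 0 < δ → 0 < Q →
        (volume (Metric.ball (0 : EuclideanSpace ℝ (Fin d)) 1)).toReal * δ ^ d ≤ m →
        Q / m ^ (((d : ℝ) - 1 + α) / (2 * d)) ≤ Q₀ * δ ^ d / m →
        ∀ E : Set (EuclideanSpace ℝ (Fin d)), IsClosed E →
          (volume E).toReal = m → BallCond δ E →
          Fen α Q E ≤ Fen α Q (Metric.closedBall (0 : EuclideanSpace ℝ (Fin d))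
            ((m / (volume (Metric.ball (0 : EuclideanSpace ℝ (Fin d)) 1)).toReal)
              ^ (1 / (d : ℝ)))) →
          IsConnected E := by
  obtain ⟨k, rfl⟩ : ∃ k, d = k + 1 := ⟨d - 1, by omega⟩
  have hdim : ((k + 1 : ℕ) : ℝ) - 1 = k := by push_cast; ring
  rw [hdim] at hαd
  simp only [hdim]
  set ω := (volume (ball (0 : EuclideanSpace ℝ (Fin (k + 1))) 1)).toReal with hω_def
  have hω : 0 < ω := toReal_pos (measure_ball_pos _ _ one_pos).ne' measure_ball_lt_top.ne
  have hroot : ∀ t : ℝ, 0 ≤ t → (t ^ (1 / ((k + 1 : ℕ) : ℝ))) ^ (k + 1) = t := fun t ht => by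
    rw [one_div, Real.rpow_inv_natCast_pow ht (by omega)]
  set w := ω ^ (1 / ((k + 1 : ℕ) : ℝ))
  have hw : 0 < w := by positivity
  have hBw : volume (ball (0 : EuclideanSpace ℝ (Fin (k + 1))) 1) =
      ENNReal.ofReal (w ^ (k + 1)) := by
    rw [hroot ω hω.le, hω_def, ofReal_toReal measure_ball_lt_top.ne]
  obtain ⟨C, hC, hI⟩ := rieszEnergy_closedBall_le (k := k) (hαd.trans (lt_add_one _))
  set D := (tubeConst k * C).toReal
  have hD : tubeConst k * C = ENNReal.ofReal D :=
    (ofReal_toReal (mul_ne_top tubeConst_ne_top hC)).symm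
  have hD0 : 0 ≤ D := toReal_nonneg
  set a := D * w ^ α / ((k + 1) * w * w ^ (2 * (k + 1))) with ha_def
  have ha : 0 ≤ a := by positivity
  refine ⟨1 / (2 * (k + 1) * (a + 1)), by positivity, ?_⟩
  set Q₀ : ℝ := 1 / (2 * (k + 1) * (a + 1)) with hQ₀_def
  have hQ₀ : 0 < Q₀ := by positivity
  have hQ₀1 : Q₀ ≤ 1 := by
    rw [hQ₀_def, div_le_one (by positivity)]
    nlinarith [k.cast_nonneg (α := ℝ)]
  have hc : a * Q₀ ^ 2 < 1 / (2 * (k + 1)) := by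
    calc a * Q₀ ^ 2 ≤ a * Q₀ := by gcongr; nlinarith
      _ < (a + 1) * Q₀ := by nlinarith
      _ = _ := by rw [hQ₀_def]; field_simp
  intro δ m Q hδ hQ hm hQm A hA hAm hAδ hF
  have hm0 : 0 < m := lt_of_lt_of_le (by positivity) hm
  set U := m ^ (1 / ((k + 1 : ℕ) : ℝ))
  have hU : 0 < U := by positivity
  have hUm : U ^ (k + 1) = m := hroot m hm0.le
  have hr : (m / ω) ^ (1 / ((k + 1 : ℕ) : ℝ)) = U / w := Real.div_rpow hm0.le hω.le _
  rw [hr] at hF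
  have hAU : volume A = ENNReal.ofReal (U ^ (k + 1)) := by
    rw [hUm, ← hAm, ofReal_toReal fun h => ?_]
    rw [h, toReal_top] at hAm
    exact hm0.ne hAm
  refine ⟨nonempty_of_measure_ne_zero (μ := volume) ?_, ?_⟩
  · rw [hAU]
    exact (ofReal_pos.2 (by positivity)).ne'
  refine isPreconnected_of_fen_le hδ hU hw hBw (hI _ (by positivity)) hD hD0 hA hAU hAδ hF hc ?_
  rw [← hUm] at hQm
  push_cast at hQm
  calc Q ^ 2 * (U / w) ^ (-α) * D
      ≤ Q₀ ^ 2 * (δ / U) ^ (2 * (k + 1)) * U ^ k * w ^ α * D := by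
        refine mul_le_mul_of_nonneg_right ?_ hD0
        exact sq_mul_rpow_le_of_div_le hδ hU hw hQ hQm
    _ = _ := by
      rw [ha_def, mul_div_assoc w, mul_pow w]
      field_simp
end
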